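/- arXiv:2006.04659 — 4 statements merged into one kernel-verified Lean document; each statement's English description precedes it below -/
import Mathlib

section
/- Let α > 0, δ > 0, μ ∈ ℝ, t > 0, and let f(x,t) be the symmetric NIG density. Then for every c₁ > 0 and every x ∈ ℝ with x ≠ μt, the Mellin–Barnes representation f(x,t) = (α/(2π)) e^{αδt} · (1/(2π)) ∫_ℝ Γ((c₁+iu)/2) · K_{1−(c₁+iu)/2}(αδt) · (2δt/α)^{(c₁+iu)/2} · |x−μt|^{−(c₁+iu)} du holds, i.e. f(x,t) equals (α/(2π)) e^{αδt} times the integral of Γ(s/2) K_{1−s/2}(αδt) (2δt/α)^{s/2} |x−μt|^{−s} ds/(2iπ) along the vertical line Re(s) = c₁. -/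
open MeasureTheory

/-- Modified Bessel function of the second kind, complex index `ν`, real argument `z`. -/
noncomputable def besselK (ν : ℂ) (z : ℝ) : ℂ :=
  (1 / 2) * ((z : ℂ) / 2) ^ ν *
    ∫ t in Set.Ioi (0 : ℝ), Complex.exp (-(t : ℂ) - (z : ℂ) ^ 2 / (4 * (t : ℂ))) *
      (t : ℂ) ^ (-ν - 1)

/-- Modified Bessel function of the second kind, real index `ν`, real argument `z`. -/
noncomputable def besselKr (ν : ℝ) (z : ℝ) : ℝ :=
  (1 / 2) * (z / 2) ^ ν *
    ∫ t in Set.Ioi (0 : ℝ), Real.exp (-t - z ^ 2 / (4 * t)) * t ^ (-ν - 1)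

/-- Symmetric NIG density at time `t`. -/
noncomputable def nigDensity (α δ μ x t : ℝ) : ℝ :=
  (α * δ * t / Real.pi) * Real.exp (α * δ * t) *
    besselKr 1 (α * Real.sqrt ((δ * t) ^ 2 + (x - μ * t) ^ 2)) /
    Real.sqrt ((δ * t) ^ 2 + (x - μ * t) ^ 2)

open Complex Set in
lemma norm_Gamma_le_aux (s : ℂ) (hs : 0 < s.re) : ‖Complex.Gamma s‖ ≤ Real.Gamma s.re := by
  rw [Complex.Gamma_eq_integral hs, Complex.GammaIntegral, Real.Gamma_eq_integral hs]
  refine (norm_integral_le_integral_norm _).trans (le_of_eq ?_)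
  refine setIntegral_congr_fun measurableSet_Ioi fun w hw => ?_
  have hw' : 0 < w := hw
  simp only [norm_mul, Complex.norm_real, Complex.norm_cpow_eq_rpow_re_of_pos hw']
  simp

lemma Gamma_line_continuous (σ : ℝ) (hσ : 0 < σ) :
    Continuous fun u : ℝ => Complex.Gamma ((σ : ℂ) + (u : ℂ) * Complex.I) := by
  rw [continuous_iff_continuousAt]
  intro u
  have h : ContinuousAt Complex.Gamma ((σ : ℂ) + (u : ℂ) * Complex.I) := by
    refine (Complex.differentiableAt_Gamma _ fun m h => ?_).continuousAt
    have := congrArg Complex.re h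
    simp at this
    have h2 : (0 : ℝ) ≤ m := Nat.cast_nonneg m
    linarith
  exact ContinuousAt.comp (f := fun u : ℝ => ((σ : ℂ) + (u : ℂ) * Complex.I)) h (by fun_prop)

lemma Gamma_line_integrable (σ : ℝ) (hσ : 0 < σ) :
    Integrable fun u : ℝ => Complex.Gamma ((σ : ℂ) + (u : ℂ) * Complex.I) := by
  set m : ℝ := min (σ ^ 2) 1 with hm
  have hm0 : 0 < m := lt_min (by positivity) one_pos
  refine ((integrable_inv_one_add_sq.const_mul (Real.Gamma (σ + 2) / m))).mono'
    (Gamma_line_continuous σ hσ).aestronglyMeasurable (Filter.Eventually.of_forall fun u => ?_)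
  set s : ℂ := (σ : ℂ) + (u : ℂ) * Complex.I with hs
  have hre : s.re = σ := by simp [hs]
  have him : s.im = u := by simp [hs]
  have h0 : s ≠ 0 := fun h => by rw [h] at hre; simp at hre; linarith
  have h1 : s + 1 ≠ 0 := fun h => by
    have := congrArg Complex.re h
    simp [hre] at this; linarith
  have e : Complex.Gamma (s + 2) = (s + 1) * (s * Complex.Gamma s) := by
    rw [← Complex.Gamma_add_one s h0, ← Complex.Gamma_add_one _ h1]
    ring_nf
  have b := norm_Gamma_le_aux (s + 2) (by simp [hre]; linarith)
  rw [e, norm_mul, norm_mul] at b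
  have hr2 : (s + 2).re = σ + 2 := by simp [hre]
  rw [hr2] at b
  have n1 : ‖s‖ ^ 2 = σ ^ 2 + u ^ 2 := by
    rw [Complex.sq_norm, Complex.normSq_apply, hre, him]; ring
  have n2 : ‖s + 1‖ ^ 2 = (σ + 1) ^ 2 + u ^ 2 := by
    rw [Complex.sq_norm, Complex.normSq_apply]; simp [hre, him]; ring
  have n3 : ‖s‖ ≤ ‖s + 1‖ := by
    apply le_of_sq_le_sq _ (norm_nonneg _)
    rw [n1, n2]; nlinarith
  have n4 : m * (1 + u ^ 2) ≤ ‖s‖ ^ 2 := by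
    rw [n1]
    have := min_le_left (σ ^ 2) 1
    have := min_le_right (σ ^ 2) 1
    nlinarith [sq_nonneg u]
  have n5 : m * (1 + u ^ 2) * ‖Complex.Gamma s‖ ≤ Real.Gamma (σ + 2) := by
    refine le_trans ?_ b
    rw [← mul_assoc]
    refine mul_le_mul_of_nonneg_right ?_ (norm_nonneg _)
    nlinarith [norm_nonneg s]
  rw [← div_eq_mul_inv, div_div, le_div_iff₀ (by positivity)]
  linarith

lemma exp_mellin_inv (σ : ℝ) (hσ : 0 < σ) (p : ℝ) (hp : 0 < p) :
    ∫ y : ℝ, (p : ℂ) ^ (-((σ : ℂ) + (y : ℂ) * Complex.I)) *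
      Complex.Gamma ((σ : ℂ) + (y : ℂ) * Complex.I) = 2 * Real.pi * (Real.exp (-p) : ℂ) := by
  have key : ∀ s : ℂ, 0 < s.re →
      mellin (fun x => ((Real.exp (-x) : ℝ) : ℂ)) s = Complex.Gamma s := by
    intro s hs
    rw [Complex.Gamma_eq_integral hs, Complex.GammaIntegral_eq_mellin]
  have hc : MellinConvergent (fun x => ((Real.exp (-x) : ℝ) : ℂ)) (σ : ℂ) := by
    have := Complex.GammaIntegral_convergent (s := (σ : ℂ)) (by simpa using hσ)
    refine this.congr_fun (fun x _ => ?_) measurableSet_Ioi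
    simp [mul_comm]
  have hk : ∀ y : ℝ, mellin (fun x => ((Real.exp (-x) : ℝ) : ℂ)) ((σ : ℂ) + (y : ℂ) * Complex.I)
      = Complex.Gamma ((σ : ℂ) + (y : ℂ) * Complex.I) := fun y => key _ (by simpa using hσ)
  have hv : Complex.VerticalIntegrable (mellin (fun x => ((Real.exp (-x) : ℝ) : ℂ))) σ := by
    unfold Complex.VerticalIntegrable
    simp_rw [hk]
    exact Gamma_line_integrable σ hσ
  have := mellinInv_mellin_eq σ _ hp hc hv (by fun_prop)
  unfold mellinInv at this
  simp_rw [hk, smul_eq_mul] at this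
  rw [← this]
  have : (Real.pi : ℂ) ≠ 0 := by exact_mod_cast Real.pi_ne_zero
  rw [Complex.real_smul]
  generalize (∫ y : ℝ, (p : ℂ) ^ (-((σ : ℂ) + (y : ℂ) * Complex.I)) *
      Complex.Gamma ((σ : ℂ) + (y : ℂ) * Complex.I)) = J
  push_cast
  field_simp

lemma exp_mellin_inv2 (c : ℝ) (hc : 0 < c) (p : ℝ) (hp : 0 < p) :
    ∫ u : ℝ, (p : ℂ) ^ (-(((c : ℂ) + (u : ℂ) * Complex.I) / 2)) *
      Complex.Gamma (((c : ℂ) + (u : ℂ) * Complex.I) / 2) = 4 * Real.pi * (Real.exp (-p) : ℂ) := by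
  have h := exp_mellin_inv (c / 2) (by positivity) p hp
  have h2 := Measure.integral_comp_mul_right (fun y : ℝ =>
    (p : ℂ) ^ (-(((c / 2 : ℝ) : ℂ) + (y : ℂ) * Complex.I)) *
      Complex.Gamma (((c / 2 : ℝ) : ℂ) + (y : ℂ) * Complex.I)) (1 / 2)
  rw [h] at h2
  have e : ∀ u : ℝ, ((c : ℂ) + (u : ℂ) * Complex.I) / 2 =
      ((c / 2 : ℝ) : ℂ) + ((u * (1 / 2) : ℝ) : ℂ) * Complex.I := by
    intro u; push_cast; ring
  simp_rw [e, h2]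
  rw [Complex.real_smul]
  norm_num
  ring

lemma kernel_integrable (c z : ℝ) (hc : 0 < c) (hz : 0 < z) :
    IntegrableOn (fun w : ℝ => Real.exp (-w - z ^ 2 / (4 * w)) * w ^ (c / 2 - 2))
      (Set.Ioi 0) := by
  have h := (Real.GammaIntegral_convergent (s := c / 2 + 1) (by positivity)).const_mul
    (32 / z ^ 4)
  refine h.mono' (by fun_prop) ?_
  filter_upwards [ae_restrict_mem measurableSet_Ioi] with w hw
  have hw' : 0 < w := hw
  rw [Real.norm_of_nonneg (by positivity)]
  have q := Real.quadratic_le_exp_of_nonneg (x := z ^ 2 / (4 * w)) (by positivity)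
  have q2 : (z ^ 2 / (4 * w)) ^ 2 / 2 ≤ Real.exp (z ^ 2 / (4 * w)) := by
    have : 0 ≤ z ^ 2 / (4 * w) := by positivity
    linarith
  have q3 : Real.exp (-(z ^ 2 / (4 * w))) ≤ 32 / z ^ 4 * w ^ 2 := by
    rw [Real.exp_neg]
    calc _ ≤ ((z ^ 2 / (4 * w)) ^ 2 / 2)⁻¹ := inv_anti₀ (by positivity) q2
      _ = _ := by field_simp; norm_num
  have e1 : w ^ (c / 2 + 1 - 1) = w ^ 2 * w ^ (c / 2 - 2) := by
    rw [← Real.rpow_natCast w 2, ← Real.rpow_add hw']; congr 1; push_cast; ring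
  rw [e1, sub_eq_add_neg (-w), Real.exp_add]
  have := mul_le_mul_of_nonneg_left q3
    (mul_nonneg (Real.exp_pos (-w)).le (Real.rpow_nonneg hw'.le (c / 2 - 2)))
  linarith

/-- The two-variable integrand. -/
noncomputable def nigAux (c z P : ℝ) (u w : ℝ) : ℂ :=
  (P : ℂ) ^ (-(((c : ℂ) + (u : ℂ) * Complex.I) / 2)) *
    Complex.Gamma (((c : ℂ) + (u : ℂ) * Complex.I) / 2) *
    (((Real.exp (-w - z ^ 2 / (4 * w)) : ℝ) : ℂ) *
      (w : ℂ) ^ (((c : ℂ) + (u : ℂ) * Complex.I) / 2 - 2))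

lemma nigAux_integrable (c z P : ℝ) (hc : 0 < c) (hz : 0 < z) (hP : 0 < P) :
    Integrable (Function.uncurry (nigAux c z P))
      (volume.prod (volume.restrict (Set.Ioi 0))) := by
  have e : ∀ u : ℝ, ((c : ℂ) + (u : ℂ) * Complex.I) / 2 =
      ((c / 2 : ℝ) : ℂ) + ((u * (1 / 2) : ℝ) : ℂ) * Complex.I := by
    intro u; push_cast; ring
  have hG : Integrable fun u : ℝ => Complex.Gamma (((c : ℂ) + (u : ℂ) * Complex.I) / 2) := by
    simp_rw [e]
    exact (Gamma_line_integrable (c / 2) (by positivity)).comp_mul_right' (R := 1 / 2) (by norm_num)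
  have hGm : Continuous fun u : ℝ => Complex.Gamma (((c : ℂ) + (u : ℂ) * Complex.I) / 2) := by
    simp_rw [e]
    exact (Gamma_line_continuous (c / 2) (by positivity)).comp (continuous_id.mul_const (1 / 2))
  have hprod := (hG.norm.const_mul (P ^ (-(c / 2)))).mul_prod (kernel_integrable c z hc hz)
  refine hprod.mono' ?_ ?_
  · apply Measurable.aestronglyMeasurable
    have hGm' : Measurable fun q : ℝ × ℝ =>
        Complex.Gamma (((c : ℂ) + (q.1 : ℂ) * Complex.I) / 2) := hGm.measurable.comp measurable_fst
    unfold nigAux Function.uncurry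
    refine Measurable.mul (Measurable.mul ?_ hGm') ?_ <;> fun_prop
  · have : ∀ᵐ q : ℝ × ℝ ∂(volume.prod (volume.restrict (Set.Ioi (0 : ℝ)))), q.2 ∈ Set.Ioi (0 : ℝ) :=
      Measure.quasiMeasurePreserving_snd.ae (ae_restrict_mem measurableSet_Ioi)
    filter_upwards [this] with q hq
    have hq' : 0 < q.2 := hq
    simp only [Function.uncurry, nigAux, norm_mul, Complex.norm_cpow_eq_rpow_re_of_pos hP,
      Complex.norm_cpow_eq_rpow_re_of_pos hq', Complex.norm_real]
    apply le_of_eq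
    rw [Real.norm_of_nonneg (Real.exp_pos _).le]
    simp

lemma nigAux_inner (c z P : ℝ) (hc : 0 < c) (hP : 0 < P) (w : ℝ) (hw : 0 < w) :
    ∫ u, nigAux c z P u w = ((4 * Real.pi * (Real.exp (-w - z ^ 2 / (4 * w)) *
      Real.exp (-(P / w)) * w ^ (-2 : ℝ)) : ℝ) : ℂ) := by
  have h := exp_mellin_inv2 c hc (P / w) (by positivity)
  have hw0 : (w : ℂ) ≠ 0 := by exact_mod_cast hw.ne'
  have e : ∀ u, nigAux c z P u w = ((Real.exp (-w - z ^ 2 / (4 * w)) * w ^ (-2 : ℝ) : ℝ) : ℂ) *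
      (((P / w : ℝ) : ℂ) ^ (-(((c : ℂ) + (u : ℂ) * Complex.I) / 2)) *
      Complex.Gamma (((c : ℂ) + (u : ℂ) * Complex.I) / 2)) := by
    intro u
    unfold nigAux
    rw [div_eq_mul_inv P w, Complex.ofReal_mul P, Complex.mul_cpow_ofReal_nonneg hP.le
      (inv_nonneg.2 hw.le), sub_eq_add_neg (_ / 2 : ℂ) 2, Complex.cpow_add _ _ hw0, Complex.ofReal_mul,
      Complex.ofReal_cpow hw.le, Complex.ofReal_inv, Complex.inv_cpow, Complex.cpow_neg (w : ℂ)
        (_ / 2), inv_inv]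
    · push_cast; ring
    · rw [Complex.arg_ofReal_of_nonneg hw.le]; exact Real.pi_ne_zero.symm
  simp_rw [e]
  rw [integral_const_mul, h]
  push_cast
  ring

lemma cpow_collect (α D y : ℝ) (hα : 0 < α) (hD : 0 < D) (hy : 0 < y) (S : ℂ) :
    ((α * D : ℝ) / 2 : ℂ) ^ (1 - S) * ((2 * D / α : ℝ) : ℂ) ^ S * (y : ℂ) ^ (-(2 * S)) =
      ((α * D / 2 : ℝ) : ℂ) * ((α ^ 2 * y ^ 2 / 4 : ℝ) : ℂ) ^ (-S) := by
  have cp : ∀ (r : ℝ) (_ : 0 < r) (a : ℂ), (r : ℂ) ^ a = Complex.exp (Real.log r * a) := by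
    intro r hr a
    rw [Complex.cpow_def_of_ne_zero (by exact_mod_cast hr.ne'), Complex.ofReal_log hr.le]
  have e0 : ((α * D : ℝ) / 2 : ℂ) = ((α * D / 2 : ℝ) : ℂ) := by push_cast; ring
  have e1 : ((α * D / 2 : ℝ) : ℂ) = Complex.exp (Real.log (α * D / 2)) := by
    rw [← Complex.ofReal_exp, Real.exp_log (by positivity)]
  rw [e0, cp _ (by positivity), cp _ (by positivity), cp _ hy, cp (α ^ 2 * y ^ 2 / 4) (by positivity)]
  conv_rhs => rw [e1]
  rw [← Complex.exp_add, ← Complex.exp_add, ← Complex.exp_add]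
  congr 1
  have l4 : Real.log 4 = 2 * Real.log 2 := by
    rw [show (4 : ℝ) = 2 ^ 2 by norm_num, Real.log_pow]; norm_num
  rw [Real.log_div (by positivity) (by norm_num), Real.log_div (by positivity) (by positivity),
    Real.log_div (by positivity) (by norm_num), Real.log_mul hα.ne' hD.ne',
    Real.log_mul (by norm_num) hD.ne', Real.log_mul (by positivity) (by positivity), Real.log_pow,
    Real.log_pow, l4]
  push_cast
  ring

lemma integrand_eq (α D y c u : ℝ) (hα : 0 < α) (hD : 0 < D) (hy : 0 < y) :
    Complex.Gamma (((c : ℂ) + (u : ℂ) * Complex.I) / 2) *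
      besselK (1 - ((c : ℂ) + (u : ℂ) * Complex.I) / 2) (α * D) *
      ((2 * D / α : ℝ) : ℂ) ^ (((c : ℂ) + (u : ℂ) * Complex.I) / 2) *
      ((y : ℝ) : ℂ) ^ (-((c : ℂ) + (u : ℂ) * Complex.I)) =
    ((α * D / 4 : ℝ) : ℂ) *
      ∫ w in Set.Ioi (0 : ℝ), nigAux c (α * D) (α ^ 2 * y ^ 2 / 4) u w := by
  obtain ⟨S, hS⟩ : ∃ S : ℂ, S = ((c : ℂ) + (u : ℂ) * Complex.I) / 2 := ⟨_, rfl⟩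
  have h2 : (c : ℂ) + (u : ℂ) * Complex.I = 2 * S := by rw [hS]; ring
  unfold nigAux
  rw [← hS, h2, integral_const_mul]
  have h := cpow_collect α D y hα hD hy S
  unfold besselK
  have hi : ∫ t in Set.Ioi (0 : ℝ), Complex.exp (-(t : ℂ) - ((α * D : ℝ) : ℂ) ^ 2 / (4 * (t : ℂ))) *
      (t : ℂ) ^ (-(1 - S) - 1) = ∫ w in Set.Ioi (0 : ℝ),
      (((Real.exp (-w - (α * D) ^ 2 / (4 * w)) : ℝ) : ℂ) * (w : ℂ) ^ (S - 2)) := by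
    congr 1
    ext w
    rw [show -(1 - S) - 1 = S - 2 by ring]
    push_cast
    rfl
  rw [hi]
  generalize (∫ w in Set.Ioi (0 : ℝ),
      (((Real.exp (-w - (α * D) ^ 2 / (4 * w)) : ℝ) : ℂ) * (w : ℂ) ^ (S - 2))) = J
  calc _ = Complex.Gamma S * J * (1 / 2) * (((α * D : ℝ) / 2 : ℂ) ^ (1 - S) *
        ((2 * D / α : ℝ) : ℂ) ^ S * (y : ℂ) ^ (-(2 * S))) := by ring
    _ = _ := by rw [h]; push_cast; ring

lemma nig_rhs (α D y c : ℝ) (hα : 0 < α) (hD : 0 < D) (hy : 0 < y) (hc : 0 < c) :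
    ∫ u : ℝ, Complex.Gamma (((c : ℂ) + (u : ℂ) * Complex.I) / 2) *
      besselK (1 - ((c : ℂ) + (u : ℂ) * Complex.I) / 2) (α * D) *
      ((2 * D / α : ℝ) : ℂ) ^ (((c : ℂ) + (u : ℂ) * Complex.I) / 2) *
      ((y : ℝ) : ℂ) ^ (-((c : ℂ) + (u : ℂ) * Complex.I)) =
    ((α * D * Real.pi * ∫ w in Set.Ioi (0 : ℝ),
      Real.exp (-w - (α * Real.sqrt (D ^ 2 + y ^ 2)) ^ 2 / (4 * w)) * w ^ (-(1 : ℝ) - 1) : ℝ) : ℂ) := by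
  have hP : 0 < α ^ 2 * y ^ 2 / 4 := by positivity
  simp_rw [integrand_eq α D y c _ hα hD hy]
  rw [integral_const_mul,
    integral_integral_swap (nigAux_integrable c (α * D) _ hc (by positivity) hP)]
  rw [setIntegral_congr_fun (g := fun w => ((4 * Real.pi * (Real.exp (-w - (α * D) ^ 2 / (4 * w)) *
      Real.exp (-((α ^ 2 * y ^ 2 / 4) / w)) * w ^ (-2 : ℝ)) : ℝ) : ℂ)) measurableSet_Ioi
      (fun w hw => nigAux_inner c (α * D) _ hc hP w hw)]
  rw [integral_complex_ofReal, integral_const_mul]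
  rw [setIntegral_congr_fun (g := fun w =>
      Real.exp (-w - (α * Real.sqrt (D ^ 2 + y ^ 2)) ^ 2 / (4 * w)) * w ^ (-(1 : ℝ) - 1))
      measurableSet_Ioi]
  · push_cast; ring
  · intro w hw
    have hw' : 0 < w := hw
    simp only
    rw [← Real.exp_add, mul_pow α (Real.sqrt _), Real.sq_sqrt (by positivity)]
    congr 2
    · field_simp; ring
    · norm_num

/-- Mellin–Barnes representation of the symmetric NIG density. -/
theorem nig_density_mellin_barnes
    (α δ μ t : ℝ) (hα : 0 < α) (hδ : 0 < δ) (ht : 0 < t)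
    (c₁ : ℝ) (hc₁ : 0 < c₁) (x : ℝ) (hx : x ≠ μ * t) :
    (nigDensity α δ μ x t : ℂ) =
      ((α / (2 * Real.pi) * Real.exp (α * δ * t) : ℝ) : ℂ) *
        ((1 / (2 * Real.pi) : ℝ) : ℂ) *
        ∫ u : ℝ,
          Complex.Gamma (((c₁ : ℂ) + (u : ℂ) * Complex.I) / 2) *
            besselK (1 - ((c₁ : ℂ) + (u : ℂ) * Complex.I) / 2) (α * δ * t) *
            ((2 * δ * t / α : ℝ) : ℂ) ^ (((c₁ : ℂ) + (u : ℂ) * Complex.I) / 2) *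
            ((|x - μ * t| : ℝ) : ℂ) ^ (-((c₁ : ℂ) + (u : ℂ) * Complex.I)) := by
  have hD : 0 < δ * t := by positivity
  have hy : 0 < |x - μ * t| := abs_pos.2 (sub_ne_zero.2 hx)
  have h := nig_rhs α (δ * t) |x - μ * t| c₁ hα hD hy hc₁
  rw [← mul_assoc, ← mul_assoc] at h
  rw [h, sq_abs]
  unfold nigDensity besselKr
  have hR : 0 < Real.sqrt ((δ * t) ^ 2 + (x - μ * t) ^ 2) := Real.sqrt_pos.2 (by positivity)
  rw [← Complex.ofReal_mul, ← Complex.ofReal_mul]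
  congr 1
  rw [Real.rpow_one]
  have := Real.pi_pos
  generalize (∫ w in Set.Ioi (0 : ℝ), Real.exp (-w - (α * Real.sqrt ((δ * t) ^ 2 +
    (x - μ * t) ^ 2)) ^ 2 / (4 * w)) * w ^ (-(1 : ℝ) - 1)) = J
  field_simp
end

section
/- Cash-or-nothing call (symmetric model): assume |k₀| < δτ. Then the price C_{c/n} := e^{−rτ} ∫_ℝ 1_{{x > −k}} f(x,τ) dx of the cash-or-nothing call (payoff 1_{{S_T > K}}) equals the convergent series C_{c/n} = (α e^{(αδ−r)τ}/√π) · Σ_{n=0}^∞ [k₀^{n} / (n! Γ(1 − n/2))] · K_{(n+1)/2}(αδτ) · (δτ/(2α))^{(1−n)/2}. -/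
open MeasureTheory

/-- General term of the cash-or-nothing call series in the symmetric model. -/
noncomputable def cnTerm (α δ τ k₀ : ℝ) (n : ℕ) : ℝ :=
  k₀ ^ n / (n.factorial : ℝ) * (Real.Gamma (1 - (n : ℝ) / 2))⁻¹ *
    besselKr (((n : ℝ) + 1) / 2) (α * δ * τ) *
    (δ * τ / (2 * α)) ^ ((1 - (n : ℝ)) / 2)


lemma aux_integrable (c s : ℝ) (hc : 0 < c) :
    IntegrableOn (fun t : ℝ => Real.exp (-t - c / (4 * t)) * t ^ s) (Set.Ioi 0) := by
  obtain ⟨N, hN⟩ := exists_nat_gt (-s)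
  have h1 := (Real.GammaIntegral_convergent (s := s + N + 1) (by linarith)).const_mul
    ((N.factorial : ℝ) * (4 / c) ^ N)
  refine Integrable.mono' h1 ?_ ?_
  · exact Measurable.aestronglyMeasurable (by fun_prop)
  · refine (ae_restrict_iff' measurableSet_Ioi).2 (Filter.Eventually.of_forall fun t ht => ?_)
    have ht : 0 < t := ht
    have hE := Real.pow_div_factorial_le_exp (x := c / (4 * t)) (by positivity) N
    have hts : 0 < t ^ s := Real.rpow_pos_of_pos ht s
    rw [Real.norm_of_nonneg (by positivity)]
    have e1 : Real.exp (-t - c / (4 * t)) = Real.exp (-t) * (Real.exp (c / (4 * t)))⁻¹ := by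
      rw [sub_eq_add_neg, Real.exp_add, Real.exp_neg (c / (4 * t))]
    have e2 : t ^ (s + N + 1 - 1) = t ^ s * t ^ N := by
      rw [add_sub_cancel_right, Real.rpow_add ht, Real.rpow_natCast]
    have hle : (Real.exp (c / (4 * t)))⁻¹ ≤ (N.factorial : ℝ) * (4 / c) ^ N * t ^ N := by
      have := inv_anti₀ (by positivity) hE
      refine this.trans (le_of_eq ?_)
      rw [div_pow, div_pow, mul_pow]
      field_simp
    rw [e1, e2]
    calc _ = (Real.exp (-t) * t ^ s) * (Real.exp (c / (4 * t)))⁻¹ := by ring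
      _ ≤ (Real.exp (-t) * t ^ s) * ((N.factorial : ℝ) * (4 / c) ^ N * t ^ N) := by gcongr
      _ = _ := by ring

lemma aux_gamma (m : ℕ) :
    Real.Gamma (1 / 2 - m) * ((2 * m).factorial : ℝ) =
      (-1) ^ m * 4 ^ m * m.factorial * Real.sqrt Real.pi := by
  induction m with
  | zero => simp [← Real.Gamma_one_half_eq]
  | succ m ih =>
    have hs : (1 / 2 - ((m + 1 : ℕ) : ℝ)) ≠ 0 := by
      push_cast
      have : (0 : ℝ) ≤ m := Nat.cast_nonneg m
      linarith
    have h := Real.Gamma_add_one hs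
    have e : (1 / 2 - ((m + 1 : ℕ) : ℝ)) + 1 = 1 / 2 - m := by push_cast; ring
    rw [e] at h
    rw [h] at ih
    have e2 : 2 * (m + 1) = 2 * m + 1 + 1 := by ring
    rw [e2, Nat.factorial_succ, Nat.factorial_succ, Nat.factorial_succ]
    push_cast at ih ⊢
    rw [pow_succ, pow_succ]
    linear_combination (-4 * (m + 1 : ℝ)) * ih

lemma aux_exp (x : ℝ) : HasSum (fun n : ℕ => x ^ n / (n.factorial : ℝ)) (Real.exp x) := by
  rw [Real.exp_eq_exp_ℝ]
  exact NormedSpace.expSeries_div_hasSum_exp x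

lemma aux_erf (b k : ℝ) :
    HasSum (fun m : ℕ => (-b) ^ m * k ^ (2 * m + 1) / ((2 * m + 1) * (m.factorial : ℝ)))
      (∫ y in (-k)..0, Real.exp (-b * y ^ 2)) := by
  have h := intervalIntegral.hasSum_integral_of_dominated_convergence
    (F := fun (m : ℕ) (y : ℝ) => (-b * y ^ 2) ^ m / (m.factorial : ℝ))
    (f := fun y => Real.exp (-b * y ^ 2)) (a := -k) (b := 0) (μ := volume)
    (fun m y => (|b| * k ^ 2) ^ m / (m.factorial : ℝ))
    (fun m => by fun_prop)
    (fun m => Filter.Eventually.of_forall fun y hy => by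
      have hy2 : y ^ 2 ≤ k ^ 2 := by
        rcases Set.mem_uIoc.1 hy with h | h <;> nlinarith [h.1, h.2]
      rw [norm_div, norm_pow, norm_mul, norm_neg, Real.norm_eq_abs, Real.norm_eq_abs,
        Real.norm_eq_abs, abs_of_nonneg (sq_nonneg y), Nat.abs_cast]
      gcongr)
    (Filter.Eventually.of_forall fun y hy => (aux_exp _).summable)
    (by simp)
    (Filter.Eventually.of_forall fun y hy => aux_exp _)
  convert! h using 1
  funext m
  have : ∀ y : ℝ, (-b * y ^ 2) ^ m / (m.factorial : ℝ)
      = (-b) ^ m / (m.factorial : ℝ) * y ^ (2 * m) := by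
    intro y; rw [mul_pow, ← pow_mul]; ring
  simp_rw [this]
  rw [intervalIntegral.integral_const_mul, integral_pow]
  rw [Odd.neg_pow ⟨m, rfl⟩]
  push_cast
  field_simp
  simp

lemma aux_gauss (b k : ℝ) (hb : 0 < b) :
    ∫ y in Set.Ioi (-k), Real.exp (-b * y ^ 2) =
      (∫ y in (-k)..0, Real.exp (-b * y ^ 2)) + Real.sqrt (Real.pi / b) / 2 := by
  have hi := integrable_exp_neg_mul_sq hb
  rw [← integral_gaussian_Ioi, intervalIntegral.integral_interval_add_Ioi hi.integrableOn hi.integrableOn]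

lemma aux_sqrt (α t : ℝ) (hα : 0 < α) (ht : 0 < t) :
    Real.sqrt (Real.pi / (α ^ 2 / (4 * t))) / 2 = Real.sqrt Real.pi / α * t ^ (1 / 2 : ℝ) := by
  rw [← Real.sqrt_eq_rpow]
  have : Real.pi / (α ^ 2 / (4 * t)) = (2 / α) ^ 2 * (Real.pi * t) := by field_simp; norm_num
  rw [this, Real.sqrt_mul (by positivity), Real.sqrt_sq (by positivity),
    Real.sqrt_mul Real.pi_pos.le]
  ring

/-- joint integrand -/
noncomputable def auxF (α z y t : ℝ) : ℝ :=
  (Real.exp (-t - z ^ 2 / (4 * t)) * t ^ (-1 - 1 : ℝ)) * Real.exp (-(α ^ 2 / (4 * t)) * y ^ 2)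

lemma aux_prod (α z : ℝ) (hα : 0 < α) (hz : 0 < z) :
    Integrable (Function.uncurry (auxF α z)) (volume.prod (volume.restrict (Set.Ioi 0))) := by
  rw [integrable_prod_iff']
  · constructor
    · refine (ae_restrict_iff' measurableSet_Ioi).2 (Filter.Eventually.of_forall fun t ht => ?_)
      have ht : 0 < t := ht
      simp only [Function.uncurry_apply_pair, auxF]
      exact (integrable_exp_neg_mul_sq (b := α ^ 2 / (4 * t)) (by positivity)).const_mul _
    · have := (aux_integrable (z ^ 2) (-1 - 1 + 1 / 2) (by positivity)).const_mul
        (2 * (Real.sqrt Real.pi / α))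
      refine (integrableOn_congr_fun ?_ measurableSet_Ioi).1 this
      intro t ht
      have ht : 0 < t := ht
      have hn : ∀ y, ‖Function.uncurry (auxF α z) (y, t)‖ = auxF α z y t := fun y => by
        have : 0 < t ^ (-1 - 1 : ℝ) := Real.rpow_pos_of_pos ht _
        rw [Function.uncurry_apply_pair, Real.norm_of_nonneg]
        unfold auxF; positivity
      simp_rw [hn, auxF]
      rw [integral_const_mul, integral_gaussian]
      have := aux_sqrt α t hα ht
      have h2 : Real.sqrt (Real.pi / (α ^ 2 / (4 * t))) =
        2 * (Real.sqrt Real.pi / α * t ^ (1 / 2 : ℝ)) := by linarith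
      rw [h2, Real.rpow_add ht]
      ring
  · apply Measurable.aestronglyMeasurable
    unfold auxF
    fun_prop

lemma aux_swap (α z k : ℝ) (hα : 0 < α) (hz : 0 < z) :
    ∫ y in Set.Ioi (-k), ∫ t in Set.Ioi 0, auxF α z y t =
      ∫ t in Set.Ioi 0, ∫ y in Set.Ioi (-k), auxF α z y t := by
  apply integral_integral_swap
  exact (aux_prod α z hα hz).mono_measure
    (Measure.prod_mono Measure.restrict_le_self le_rfl)

/-- series integrand -/
noncomputable def auxS (α z k : ℝ) (m : ℕ) (t : ℝ) : ℝ :=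
  (Real.exp (-t - z ^ 2 / (4 * t)) * t ^ (-1 - 1 : ℝ)) *
    ((-(α ^ 2 / (4 * t))) ^ m * k ^ (2 * m + 1) / ((2 * m + 1) * (m.factorial : ℝ)))

lemma aux_series (α z k : ℝ) (hzk : (α * k) ^ 2 < z ^ 2) :
    HasSum (fun m : ℕ => ∫ t in Set.Ioi 0, auxS α z k m t)
      (∫ t in Set.Ioi 0, (Real.exp (-t - z ^ 2 / (4 * t)) * t ^ (-1 - 1 : ℝ)) *
        ∫ y in (-k)..0, Real.exp (-(α ^ 2 / (4 * t)) * y ^ 2)) := by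
  have key : ∀ t : ℝ, HasSum (fun m : ℕ => (Real.exp (-t - z ^ 2 / (4 * t)) * t ^ (-1 - 1 : ℝ)) *
      (|k| * (((α * k) ^ 2 / (4 * t)) ^ m / (m.factorial : ℝ))))
      (|k| * (Real.exp (-t - (z ^ 2 - (α * k) ^ 2) / (4 * t)) * t ^ (-1 - 1 : ℝ))) := by
    intro t
    have h := ((aux_exp ((α * k) ^ 2 / (4 * t))).mul_left |k|).mul_left
      (Real.exp (-t - z ^ 2 / (4 * t)) * t ^ (-1 - 1 : ℝ))
    convert! h using 1
    have : -t - (z ^ 2 - (α * k) ^ 2) / (4 * t)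
      = (-t - z ^ 2 / (4 * t)) + (α * k) ^ 2 / (4 * t) := by ring
    rw [this, Real.exp_add]
    ring
  refine hasSum_integral_of_dominated_convergence
    (fun m t => (Real.exp (-t - z ^ 2 / (4 * t)) * t ^ (-1 - 1 : ℝ)) *
      (|k| * (((α * k) ^ 2 / (4 * t)) ^ m / (m.factorial : ℝ)))) ?_ ?_ ?_ ?_ ?_
  · intro m
    apply Measurable.aestronglyMeasurable
    unfold auxS
    fun_prop
  · intro m
    refine (ae_restrict_iff' measurableSet_Ioi).2 (Filter.Eventually.of_forall fun t ht => ?_)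
    have ht : 0 < t := ht
    have hp : 0 < t ^ (-1 - 1 : ℝ) := Real.rpow_pos_of_pos ht _
    unfold auxS
    rw [norm_mul, Real.norm_of_nonneg (by positivity)]
    refine mul_le_mul_of_nonneg_left ?_ (by positivity)
    have hb : 0 ≤ α ^ 2 / (4 * t) := by positivity
    have hd : (0 : ℝ) ≤ (2 * m + 1) * (m.factorial : ℝ) := by positivity
    rw [norm_div, norm_mul, norm_pow, norm_pow, norm_neg, Real.norm_of_nonneg hb,
      Real.norm_of_nonneg hd, Real.norm_eq_abs, pow_succ |k|, pow_mul |k|, sq_abs]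
    have e : (α ^ 2 / (4 * t)) ^ m * ((k ^ 2) ^ m * |k|) / ((2 * m + 1) * (m.factorial : ℝ))
      = (|k| * (((α * k) ^ 2 / (4 * t)) ^ m / (m.factorial : ℝ))) / (2 * m + 1) := by
      have : (α * k) ^ 2 / (4 * t) = α ^ 2 / (4 * t) * k ^ 2 := by ring
      rw [this, mul_pow]
      field_simp
    rw [e]
    apply div_le_self (by positivity)
    have : (0 : ℝ) ≤ m := Nat.cast_nonneg m
    linarith
  · exact Filter.Eventually.of_forall fun t => (key t).summable
  · simp_rw [fun t => (key t).tsum_eq]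
    exact (aux_integrable _ _ (by linarith)).const_mul _
  · exact Filter.Eventually.of_forall fun t => (aux_erf _ _).mul_left _

lemma aux_term_even (α δ τ k : ℝ) (m : ℕ) : cnTerm α δ τ k (2 * (m + 1)) = 0 := by
  have : (1 - ((2 * (m + 1) : ℕ) : ℝ) / 2) = -(m : ℝ) := by push_cast; ring
  unfold cnTerm
  rw [this, Real.Gamma_neg_nat_eq_zero]
  simp

lemma aux_term_zero (α δ τ k : ℝ) (hα : 0 < α) (hT : 0 < δ * τ) :
    cnTerm α δ τ k 0 = δ * τ / 4 *
      ∫ t in Set.Ioi 0, Real.exp (-t - (α * δ * τ) ^ 2 / (4 * t)) * t ^ (-(1 / 2) - 1 : ℝ) := by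
  unfold cnTerm besselKr
  simp only [pow_zero, Nat.factorial_zero, Nat.cast_one, Nat.cast_zero, zero_div, sub_zero,
    Real.Gamma_one, zero_add]
  have e : (α * δ * τ / 2) ^ (1 / 2 : ℝ) * (δ * τ / (2 * α)) ^ (1 / 2 : ℝ) = δ * τ / 2 := by
    rw [← Real.mul_rpow (by rw [mul_assoc]; positivity) (by positivity), ← Real.sqrt_eq_rpow]
    have : α * δ * τ / 2 * (δ * τ / (2 * α)) = (δ * τ / 2) ^ 2 := by field_simp
    rw [this, Real.sqrt_sq (by positivity)]
  linear_combination (1 / 2 * ∫ t in Set.Ioi 0,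
    Real.exp (-t - (α * δ * τ) ^ 2 / (4 * t)) * t ^ (-(1 / 2) - 1 : ℝ)) * e

lemma aux_term_odd (α δ τ k : ℝ) (hα : 0 < α) (hT : 0 < δ * τ) (m : ℕ) :
    cnTerm α δ τ k (2 * m + 1) = α * (δ * τ) / (4 * Real.sqrt Real.pi) *
      ∫ t in Set.Ioi 0, auxS α (α * δ * τ) k m t := by
  have hS : ∫ t in Set.Ioi 0, auxS α (α * δ * τ) k m t =
      ((-(α ^ 2 / 4)) ^ m * k ^ (2 * m + 1) / ((2 * m + 1) * (m.factorial : ℝ))) *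
      ∫ t in Set.Ioi 0, Real.exp (-t - (α * δ * τ) ^ 2 / (4 * t)) * t ^ (-((m : ℝ) + 1) - 1) := by
    rw [← integral_const_mul]
    refine setIntegral_congr_fun measurableSet_Ioi fun t ht => ?_
    have ht : 0 < t := ht
    have e1 : t ^ (-((m : ℝ) + 1) - 1) = t ^ (-1 - 1 : ℝ) * (t⁻¹) ^ m := by
      have : -((m : ℝ) + 1) - 1 = (-1 - 1) + -(m : ℝ) := by ring
      rw [this, Real.rpow_add ht, Real.rpow_neg ht.le, Real.rpow_natCast, inv_pow]
    have e2 : -(α ^ 2 / (4 * t)) = -(α ^ 2 / 4) * t⁻¹ := by field_simp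
    simp only [auxS]
    rw [e1, e2, mul_pow]
    ring
  rw [hS]
  unfold cnTerm besselKr
  have i1 : (((2 * m + 1 : ℕ) : ℝ) + 1) / 2 = m + 1 := by push_cast; ring
  have i2 : (1 - ((2 * m + 1 : ℕ) : ℝ)) / 2 = -(m : ℝ) := by push_cast; ring
  have i3 : 1 - ((2 * m + 1 : ℕ) : ℝ) / 2 = 1 / 2 - m := by push_cast; ring
  rw [i1, i2, i3]
  set I := ∫ t in Set.Ioi 0, Real.exp (-t - (α * δ * τ) ^ 2 / (4 * t)) * t ^ (-((m : ℝ) + 1) - 1)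
  have hT' : 0 < α * δ * τ / 2 := by rw [mul_assoc]; positivity
  have e : (α * δ * τ / 2) ^ ((m : ℝ) + 1) * (δ * τ / (2 * α)) ^ (-(m : ℝ))
      = α * (δ * τ) / 2 * (α ^ 2) ^ m := by
    rw [Real.rpow_add hT', Real.rpow_one, Real.rpow_neg (by positivity), Real.rpow_natCast,
      Real.rpow_natCast, ← inv_pow]
    have : α ^ 2 = α * δ * τ / 2 * (δ * τ / (2 * α))⁻¹ := by
      have := hT.ne'
      generalize hTT : δ * τ = T at *
      rw [mul_assoc, hTT]
      field_simp
    rw [this, mul_pow]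
    ring
  have hG := aux_gamma m
  have hsp : 0 < Real.sqrt Real.pi := Real.sqrt_pos.2 Real.pi_pos
  have hf : (0 : ℝ) < m.factorial := by positivity
  have hf2 : (0 : ℝ) < (2 * m).factorial := by positivity
  have hne : ((-1 : ℝ)) ^ m ≠ 0 := pow_ne_zero _ (by norm_num)
  have hsq : ((-1 : ℝ)) ^ m * (-1) ^ m = 1 := by rw [← mul_pow]; norm_num
  have hGi : (Real.Gamma (1 / 2 - m))⁻¹ =
      (-1) ^ m * (2 * m).factorial / (4 ^ m * m.factorial * Real.sqrt Real.pi) := by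
    have hG2 : Real.Gamma (1 / 2 - m) =
      (-1) ^ m * 4 ^ m * m.factorial * Real.sqrt Real.pi / (2 * m).factorial := by
      rw [eq_div_iff hf2.ne']; exact hG
    rw [hG2]
    field_simp
    linarith
  have hn : (-(α ^ 2 / 4)) ^ m = (-1) ^ m * (α ^ 2) ^ m / 4 ^ m := by
    rw [← mul_pow, ← div_pow]; ring
  rw [hGi, hn, Nat.factorial_succ]
  push_cast
  have hm : (2 * (m : ℝ) + 1) ≠ 0 := by positivity
  calc _ = k ^ (2 * m + 1) / ((2 * m + 1) * ((2 * m).factorial : ℝ)) *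
      ((-1) ^ m * (2 * m).factorial / (4 ^ m * m.factorial * Real.sqrt Real.pi)) * (1 / 2 * I) *
      ((α * δ * τ / 2) ^ ((m : ℝ) + 1) * (δ * τ / (2 * α)) ^ (-(m : ℝ))) := by ring
    _ = _ := by
      rw [e]
      field_simp
      ring

lemma aux_density (α δ μ x τ : ℝ) (hα : 0 < α) (hT : 0 < δ * τ) :
    nigDensity α δ μ x τ = (α * δ * τ / Real.pi) * Real.exp (α * δ * τ) * (α / 4) *
      ∫ t in Set.Ioi 0, auxF α (α * δ * τ) (x - μ * τ) t := by
  unfold nigDensity besselKr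
  have hR : 0 < (δ * τ) ^ 2 + (x - μ * τ) ^ 2 := by positivity
  have hI : ∫ t in Set.Ioi 0, auxF α (α * δ * τ) (x - μ * τ) t =
      ∫ t in Set.Ioi (0 : ℝ), Real.exp (-t - (α * Real.sqrt ((δ * τ) ^ 2 + (x - μ * τ) ^ 2)) ^ 2
        / (4 * t)) * t ^ (-1 - 1 : ℝ) := by
    refine integral_congr_ae (Filter.Eventually.of_forall fun t => ?_)
    simp only [auxF]
    rw [mul_pow α (Real.sqrt _), Real.sq_sqrt hR.le]
    have : -t - α ^ 2 * ((δ * τ) ^ 2 + (x - μ * τ) ^ 2) / (4 * t)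
      = (-t - (α * δ * τ) ^ 2 / (4 * t)) + -(α ^ 2 / (4 * t)) * (x - μ * τ) ^ 2 := by ring
    rw [this, Real.exp_add]
    ring
  rw [hI, Real.rpow_one]
  have hne := (Real.sqrt_pos.2 hR).ne'
  generalize (∫ t in Set.Ioi (0 : ℝ),
    Real.exp (-t - (α * Real.sqrt ((δ * τ) ^ 2 + (x - μ * τ) ^ 2)) ^ 2
        / (4 * t)) * t ^ (-1 - 1 : ℝ)) = I
  generalize Real.sqrt ((δ * τ) ^ 2 + (x - μ * τ) ^ 2) = R at hne
  field_simp
  ring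


lemma aux_price (α δ μ τ k : ℝ) (hα : 0 < α) (hT : 0 < δ * τ) :
    ∫ x : ℝ, (if -k < x then (1 : ℝ) else 0) * nigDensity α δ μ x τ =
      (α * δ * τ / Real.pi) * Real.exp (α * δ * τ) * (α / 4) *
      ∫ t in Set.Ioi 0, ∫ y in Set.Ioi (-(k + μ * τ)), auxF α (α * δ * τ) y t := by
  have hz : 0 < α * δ * τ := by rw [mul_assoc]; positivity
  rw [← aux_swap α (α * δ * τ) (k + μ * τ) hα hz, ← integral_const_mul,
    ← integral_indicator measurableSet_Ioi]
  refine Eq.trans ?_ (integral_sub_right_eq_self _ (μ * τ))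
  refine integral_congr_ae (Filter.Eventually.of_forall fun x => ?_)
  simp only [Set.indicator_apply, Set.mem_Ioi]
  have : -(k + μ * τ) < x - μ * τ ↔ -k < x := by constructor <;> intro h <;> linarith
  simp only [this]
  split_ifs
  · rw [one_mul, aux_density α δ μ x τ hα hT]
  · simp

lemma aux_outer (α z k : ℝ) (hα : 0 < α) (hz : 0 < z) :
    ∫ t in Set.Ioi 0, ∫ y in Set.Ioi (-k), auxF α z y t =
      (∫ t in Set.Ioi 0, (Real.exp (-t - z ^ 2 / (4 * t)) * t ^ (-1 - 1 : ℝ)) *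
        ∫ y in (-k)..0, Real.exp (-(α ^ 2 / (4 * t)) * y ^ 2)) +
      Real.sqrt Real.pi / α *
        ∫ t in Set.Ioi 0, Real.exp (-t - z ^ 2 / (4 * t)) * t ^ (-(1 / 2) - 1 : ℝ) := by
  have hA : IntegrableOn (fun t : ℝ => Real.sqrt Real.pi / α *
      (Real.exp (-t - z ^ 2 / (4 * t)) * t ^ (-(1 / 2) - 1 : ℝ))) (Set.Ioi 0) :=
    (aux_integrable _ _ (by positivity)).const_mul _
  have hpt : ∀ t ∈ Set.Ioi (0 : ℝ), ∫ y in Set.Ioi (-k), auxF α z y t =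
      (Real.exp (-t - z ^ 2 / (4 * t)) * t ^ (-1 - 1 : ℝ)) *
        (∫ y in (-k)..0, Real.exp (-(α ^ 2 / (4 * t)) * y ^ 2)) +
      Real.sqrt Real.pi / α *
        (Real.exp (-t - z ^ 2 / (4 * t)) * t ^ (-(1 / 2) - 1 : ℝ)) := by
    intro t ht
    have ht : 0 < t := ht
    simp only [auxF]
    rw [integral_const_mul, aux_gauss _ _ (by positivity), aux_sqrt α t hα ht, mul_add]
    have : t ^ (-(1 / 2) - 1 : ℝ) = t ^ (-1 - 1 : ℝ) * t ^ (1 / 2 : ℝ) := by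
      rw [← Real.rpow_add ht]; norm_num
    rw [this]
    ring
  have hF : IntegrableOn (fun t : ℝ => ∫ y in Set.Ioi (-k), auxF α z y t) (Set.Ioi 0) :=
    ((aux_prod α z hα hz).mono_measure
      (Measure.prod_mono (Measure.restrict_le_self (s := Set.Ioi (-k))) le_rfl)).integral_prod_right
  have hB : IntegrableOn (fun t : ℝ => (Real.exp (-t - z ^ 2 / (4 * t)) * t ^ (-1 - 1 : ℝ)) *
        (∫ y in (-k)..0, Real.exp (-(α ^ 2 / (4 * t)) * y ^ 2))) (Set.Ioi 0) := by
    refine (integrableOn_congr_fun ?_ measurableSet_Ioi).1 (Integrable.sub hF hA)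
    intro t ht
    simp only [Pi.sub_apply]
    rw [hpt t ht]
    ring
  rw [setIntegral_congr_fun measurableSet_Ioi hpt, integral_add hB hA, integral_const_mul]

/-- Cash-or-nothing call pricing formula in the symmetric exponential NIG model. -/
theorem cash_or_nothing_call_symmetric
    (α δ μ S K r q τ : ℝ)
    (hα : 0 < α) (hδ : 0 < δ) (hS : 0 < S) (hK : 0 < K)
    (hr : 0 ≤ r) (hq : 0 ≤ q) (hτ : 0 < τ)
    (ω k k₀ : ℝ)
    (hω : ω = -μ + δ * (Real.sqrt (α ^ 2 - 1) - α))
    (hk : k = Real.log (S / K) + (r - q + ω) * τ)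
    (hk₀ : k₀ = k + μ * τ)
    (hconv : |k₀| < δ * τ) :
    Summable (fun n : ℕ => cnTerm α δ τ k₀ n) ∧
    Real.exp (-r * τ) *
        (∫ x : ℝ, (if -k < x then (1 : ℝ) else 0) * nigDensity α δ μ x τ)
      = α * Real.exp ((α * δ - r) * τ) / Real.sqrt Real.pi *
          ∑' n : ℕ, cnTerm α δ τ k₀ n := by
  have hT : 0 < δ * τ := mul_pos hδ hτ
  have hz : 0 < α * δ * τ := by positivity
  have hzk : (α * k₀) ^ 2 < (α * δ * τ) ^ 2 := by
    rw [mul_assoc, mul_pow, mul_pow]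
    have : k₀ ^ 2 < (δ * τ) ^ 2 := by
      rw [← sq_abs k₀]
      exact pow_lt_pow_left₀ hconv (abs_nonneg _) two_ne_zero
    exact mul_lt_mul_of_pos_left this (by positivity)
  have hpi : 0 < Real.sqrt Real.pi := Real.sqrt_pos.2 Real.pi_pos
  have hodd := (aux_series α (α * δ * τ) k₀ hzk).mul_left
    (α * (δ * τ) / (4 * Real.sqrt Real.pi))
  simp_rw [← aux_term_odd α δ τ k₀ hα hT] at hodd
  have heven : HasSum (fun m : ℕ => cnTerm α δ τ k₀ (2 * m)) (cnTerm α δ τ k₀ (2 * 0)) := by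
    refine hasSum_single 0 fun m hm => ?_
    obtain ⟨j, rfl⟩ := Nat.exists_eq_succ_of_ne_zero hm
    exact aux_term_even α δ τ k₀ j
  have hsum := heven.even_add_odd hodd
  refine ⟨hsum.summable, ?_⟩
  rw [hsum.tsum_eq, aux_price α δ μ τ k hα hT, ← hk₀, aux_outer α (α * δ * τ) k₀ hα hz,
    mul_zero, aux_term_zero α δ τ k₀ hα hT]
  have hexp : Real.exp ((α * δ - r) * τ) = Real.exp (-r * τ) * Real.exp (α * δ * τ) := by
    rw [← Real.exp_add]; ring_nf
  rw [hexp]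
  generalize (∫ t in Set.Ioi (0 : ℝ), (Real.exp (-t - (α * δ * τ) ^ 2 / (4 * t)) *
    t ^ (-1 - 1 : ℝ)) * ∫ y in (-k₀)..0, Real.exp (-(α ^ 2 / (4 * t)) * y ^ 2)) = A
  generalize (∫ t in Set.Ioi (0 : ℝ), Real.exp (-t - (α * δ * τ) ^ 2 / (4 * t)) *
    t ^ (-(1 / 2) - 1 : ℝ)) = B
  have hp : Real.pi = Real.sqrt Real.pi * Real.sqrt Real.pi :=
    (Real.mul_self_sqrt Real.pi_pos.le).symm
  generalize Real.sqrt Real.pi = p at *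
  rw [hp]
  field_simp
  ring
end

section
/- Cash-or-nothing put (symmetric model): assume |k₀| < δτ. Then the price P_{c/n} := e^{−rτ} ∫_ℝ 1_{{x < −k}} f(x,τ) dx of the cash-or-nothing put (payoff 1_{{S_T < K}}) equals P_{c/n} = e^{−rτ} [ 1/2 − (α/π) e^{αδτ} · Σ_{p=0}^∞ ((−1)^p k₀^{2p+1} / (p! (2p+1))) · K_{p+1}(αδτ) · (2δτ/α)^{−p} ], where the series converges. -/
open MeasureTheory

/-- General term of the cash-or-nothing put series in the symmetric model. -/
noncomputable def cnPutTerm (α δ τ k₀ : ℝ) (p : ℕ) : ℝ :=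
  (-1 : ℝ) ^ p * k₀ ^ (2 * p + 1) / ((p.factorial : ℝ) * (2 * (p : ℝ) + 1)) *
    besselKr ((p : ℝ) + 1) (α * δ * τ) *
    (2 * δ * τ / α) ^ (-(p : ℝ))


noncomputable def nigW (B : ℝ) (n : ℕ) : ℝ :=
  ∫ t in Set.Ioi (0 : ℝ), Real.exp (-t - B / t) * (t ^ n)⁻¹

lemma nigW_integrable {B : ℝ} (hB : 0 < B) (n : ℕ) :
    IntegrableOn (fun t : ℝ => Real.exp (-t - B / t) * (t ^ n)⁻¹) (Set.Ioi 0) := by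
  have h1 : IntegrableOn (fun t : ℝ => (n.factorial / B ^ n) * Real.exp (-t)) (Set.Ioi 0) :=
    (integrableOn_exp_neg_Ioi 0).const_mul _
  refine Integrable.mono' h1 (by fun_prop) ?_
  filter_upwards [ae_restrict_mem measurableSet_Ioi] with t ht
  have ht : 0 < t := ht
  rw [Real.norm_of_nonneg (by positivity)]
  have h2 := Real.pow_div_factorial_le_exp (x := B / t) (by positivity) n
  have h3 : Real.exp (-t - B / t) = Real.exp (-t) * (Real.exp (B / t))⁻¹ := by
    rw [← Real.exp_neg, ← Real.exp_add]; ring_nf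
  rw [h3]
  have h4 : (Real.exp (B / t))⁻¹ ≤ ((B / t) ^ n / n.factorial)⁻¹ :=
    inv_anti₀ (by positivity) h2
  calc _ ≤ Real.exp (-t) * ((B / t) ^ n / n.factorial)⁻¹ * (t ^ n)⁻¹ := by gcongr
    _ = _ := by rw [div_pow]; field_simp

noncomputable def nigG (x : ℝ) : ℝ := ∫ s in (0 : ℝ)..x, Real.exp (-1 * s ^ 2)

lemma nigG_deriv (x : ℝ) : HasDerivAt nigG (Real.exp (-1 * x ^ 2)) x := by
  have hc : Continuous (fun s : ℝ => Real.exp (-1 * s ^ 2)) := by fun_prop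
  exact hc.integral_hasStrictDerivAt 0 x |>.hasDerivAt

lemma nigG_top : Filter.Tendsto nigG Filter.atTop (nhds (√Real.pi / 2)) := by
  have h := intervalIntegral_tendsto_integral_Ioi (μ := volume) (0 : ℝ)
    (integrable_exp_neg_mul_sq one_pos).integrableOn Filter.tendsto_id
  rw [integral_gaussian_Ioi] at h
  simp only [div_one] at h
  exact h

lemma nigG_neg (x : ℝ) : nigG (-x) = - nigG x := by
  unfold nigG
  have := intervalIntegral.integral_comp_neg (a := 0) (b := x)
    (fun s : ℝ => Real.exp (-1 * s ^ 2))
  simp only [neg_zero] at this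
  rw [intervalIntegral.integral_symm, ← this]
  simp

lemma nigG_bot : Filter.Tendsto nigG Filter.atBot (nhds (-(√Real.pi / 2))) := by
  have h := (nigG_top.comp Filter.tendsto_neg_atBot_atTop).neg
  refine h.congr fun x => ?_
  simp [nigG_neg]

lemma nig_half {β : ℝ} (hβ : 0 < β) :
    IntegrableOn (fun t : ℝ => Real.exp (-t - β ^ 2 / t) * (β / (t * √t))) (Set.Ioi 0) ∧
    ∫ t in Set.Ioi (0 : ℝ), Real.exp (-t - β ^ 2 / t) * (β / (t * √t))
      = √Real.pi * Real.exp (-(2 * β)) := by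
  set F : ℝ → ℝ := fun t => Real.exp (-(2 * β)) * nigG (√t - β / √t)
    - Real.exp (2 * β) * nigG (√t + β / √t) with hF
  set m : ℝ := Real.exp (-(2 * β)) * (-(√Real.pi / 2)) - Real.exp (2 * β) * (√Real.pi / 2) with hm
  have hs0 : Filter.Tendsto (fun t : ℝ => √t) (nhdsWithin 0 (Set.Ioi 0)) (nhdsWithin 0 (Set.Ioi 0)) := by
    refine tendsto_nhdsWithin_iff.2 ⟨?_, ?_⟩
    · have := (Real.continuous_sqrt.tendsto 0).mono_left (nhdsWithin_le_nhds (s := Set.Ioi 0))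
      simpa using this
    · filter_upwards [self_mem_nhdsWithin] with t ht
      exact Real.sqrt_pos.2 ht
  have hd0 : Filter.Tendsto (fun t : ℝ => β / √t) (nhdsWithin 0 (Set.Ioi 0)) Filter.atTop := by
    simp only [div_eq_mul_inv]
    exact (tendsto_inv_nhdsGT_zero.comp hs0).const_mul_atTop hβ
  have hs0' := hs0.mono_right nhdsWithin_le_nhds
  have hdi : Filter.Tendsto (fun t : ℝ => β / √t) Filter.atTop (nhds 0) :=
    Real.tendsto_sqrt_atTop.const_div_atTop β
  have hF0 : Filter.Tendsto F (nhdsWithin 0 (Set.Ioi 0)) (nhds m) := by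
    refine ((nigG_bot.comp ?_).const_mul _).sub ((nigG_top.comp ?_).const_mul _)
    · simp only [sub_eq_add_neg]
      exact hs0'.add_atBot (Filter.tendsto_neg_atTop_atBot.comp hd0)
    · exact hs0'.add_atTop hd0
  have hFi : Filter.Tendsto F Filter.atTop (nhds (Real.exp (-(2 * β)) * (√Real.pi / 2)
      - Real.exp (2 * β) * (√Real.pi / 2))) := by
    refine ((nigG_top.comp ?_).const_mul _).sub ((nigG_top.comp ?_).const_mul _)
    · simp only [sub_eq_add_neg]
      exact Real.tendsto_sqrt_atTop.atTop_add hdi.neg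
    · exact Real.tendsto_sqrt_atTop.atTop_add hdi
  have hFd : ∀ t ∈ Set.Ioi (0 : ℝ),
      HasDerivAt F (Real.exp (-t - β ^ 2 / t) * (β / (t * √t))) t := by
    intro t ht
    have ht : 0 < t := ht
    have hst : 0 < √t := Real.sqrt_pos.2 ht
    have hsq : √t ^ 2 = t := Real.sq_sqrt ht.le
    have h1 : HasDerivAt (fun t : ℝ => √t) (1 / (2 * √t)) t := Real.hasDerivAt_sqrt ht.ne'
    have h2 : HasDerivAt (fun t : ℝ => β / √t) (-(β / (2 * (t * √t)))) t := by
      have := (hasDerivAt_const t β).div h1 hst.ne'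
      refine this.congr_deriv ?_
      rw [hsq]; field_simp; simp
    have h3 := ((nigG_deriv _).comp t (h1.sub h2)).const_mul (Real.exp (-(2 * β)))
    have h4 := ((nigG_deriv _).comp t (h1.add h2)).const_mul (Real.exp (2 * β))
    refine (h3.sub h4).congr_deriv ?_
    simp only [Pi.sub_apply, Pi.add_apply]
    have e1 : Real.exp (-1 * (√t - β / √t) ^ 2) = Real.exp (2 * β) * Real.exp (-t - β ^ 2 / t) := by
      rw [← Real.exp_add]; congr 1
      have : (√t - β / √t) ^ 2 = √t ^ 2 - 2 * β + β ^ 2 / √t ^ 2 := by field_simp; ring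
      rw [this, hsq]; ring
    have e2 : Real.exp (-1 * (√t + β / √t) ^ 2) = Real.exp (-(2 * β)) * Real.exp (-t - β ^ 2 / t) := by
      rw [← Real.exp_add]; congr 1
      have : (√t + β / √t) ^ 2 = √t ^ 2 + 2 * β + β ^ 2 / √t ^ 2 := by field_simp; ring
      rw [this, hsq]; ring
    have e3 : Real.exp (-(2 * β)) * Real.exp (2 * β) = 1 := by
      rw [← Real.exp_add]; simp
    rw [e1, e2]
    linear_combination (Real.exp (-t - β ^ 2 / t) * (β / (t * √t))) * e3
  classical
  have hcont : ContinuousWithinAt (Function.update F 0 m) (Set.Ici 0) 0 := by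
    rw [continuousWithinAt_update_same, Set.Ici_sdiff_left]
    exact hF0
  have hd : ∀ t ∈ Set.Ioi (0 : ℝ),
      HasDerivAt (Function.update F 0 m) (Real.exp (-t - β ^ 2 / t) * (β / (t * √t))) t := by
    intro t ht
    refine (hFd t ht).congr_of_eventuallyEq ?_
    filter_upwards [Ioi_mem_nhds ht] with x hx
    exact Function.update_of_ne (ne_of_gt hx) _ _
  have hi : Filter.Tendsto (Function.update F 0 m) Filter.atTop
      (nhds (Real.exp (-(2 * β)) * (√Real.pi / 2) - Real.exp (2 * β) * (√Real.pi / 2))) := by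
    refine hFi.congr' ?_
    filter_upwards [Filter.eventually_gt_atTop 0] with x hx
    exact (Function.update_of_ne (ne_of_gt hx) _ _).symm
  have hpos : ∀ t ∈ Set.Ioi (0 : ℝ), 0 ≤ Real.exp (-t - β ^ 2 / t) * (β / (t * √t)) := by
    intro t ht
    have ht : 0 < t := ht
    positivity
  refine ⟨integrableOn_Ioi_deriv_of_nonneg hcont hd hpos hi, ?_⟩
  rw [integral_Ioi_of_hasDerivAt_of_nonneg hcont hd hpos hi, Function.update_self, hm]
  ring

lemma nig_hasSum_exp (x : ℝ) : HasSum (fun p : ℕ => x ^ p / (p.factorial : ℝ)) (Real.exp x) := by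
  rw [Real.exp_eq_exp_ℝ]
  exact NormedSpace.expSeries_div_hasSum_exp x

lemma nigW_total {m c : ℝ} (hm : 0 < m) (hc : 0 < c) :
    Integrable (fun y : ℝ => nigW (m ^ 2 * (c ^ 2 + y ^ 2)) 2) ∧
    ∫ y : ℝ, nigW (m ^ 2 * (c ^ 2 + y ^ 2)) 2
      = Real.pi / (m ^ 2 * c) * Real.exp (-(2 * (m * c))) := by
  obtain ⟨hi, hv⟩ := nig_half (mul_pos hm hc)
  set f : ℝ → ℝ → ℝ := fun y t =>
    Real.exp (-t - m ^ 2 * (c ^ 2 + y ^ 2) / t) * (t ^ 2)⁻¹ with hf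
  have hfac : ∀ t, 0 < t → ∀ y, f y t =
      (Real.exp (-t - (m * c) ^ 2 / t) * (t ^ 2)⁻¹) * Real.exp (-(m ^ 2 / t) * y ^ 2) := by
    intro t ht y
    have : Real.exp (-t - m ^ 2 * (c ^ 2 + y ^ 2) / t) =
      Real.exp (-t - (m * c) ^ 2 / t) * Real.exp (-(m ^ 2 / t) * y ^ 2) := by
      rw [← Real.exp_add]; congr 1; field_simp; ring
    simp only [hf, this]; ring
  have hint : ∀ t, 0 < t → ∫ y, f y t = √Real.pi / (m ^ 2 * c) *
      (Real.exp (-t - (m * c) ^ 2 / t) * (m * c / (t * √t))) := by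
    intro t ht
    simp only [hfac t ht]
    rw [integral_const_mul, integral_gaussian]
    have hst : 0 < √t := Real.sqrt_pos.2 ht
    have hsq : √t ^ 2 = t := Real.sq_sqrt ht.le
    have : √(Real.pi / (m ^ 2 / t)) = √Real.pi * √t / m := by
      rw [Real.sqrt_div Real.pi_pos.le, Real.sqrt_div (by positivity), Real.sqrt_sq hm.le]
      field_simp
    rw [this]
    field_simp
    rw [hsq]
  have hprod : Integrable (Function.uncurry f) (volume.prod (volume.restrict (Set.Ioi (0:ℝ)))) := by
    rw [integrable_prod_iff' (by
      apply Measurable.aestronglyMeasurable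
      simp only [hf, Function.uncurry_def]
      fun_prop)]
    constructor
    · filter_upwards [ae_restrict_mem measurableSet_Ioi] with t ht
      have ht : 0 < t := ht
      simp only [Function.uncurry, hfac t ht]
      exact (integrable_exp_neg_mul_sq (by positivity)).const_mul _
    · refine (hi.const_mul (√Real.pi / (m ^ 2 * c))).congr ?_
      filter_upwards [ae_restrict_mem measurableSet_Ioi] with t ht
      rw [← hint t ht]
      refine integral_congr_ae (Filter.Eventually.of_forall fun y => ?_)
      have : 0 ≤ f y t := by simp only [hf]; positivity
      simp only [Function.uncurry]
      rw [Real.norm_of_nonneg this]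
  refine ⟨hprod.integral_prod_left, ?_⟩
  have := integral_integral_swap hprod
  unfold nigW
  rw [this, setIntegral_congr_fun measurableSet_Ioi (fun t ht => hint t ht),
    integral_const_mul, hv]
  have hp : √Real.pi * √Real.pi = Real.pi := Real.mul_self_sqrt Real.pi_pos.le
  linear_combination (1 / (m ^ 2 * c) * Real.exp (-(2 * (m * c)))) * hp

lemma nigW_summable {B x : ℝ} (hx : 0 ≤ x) (hxB : x < B) :
    Summable (fun p : ℕ => nigW B (p + 2) * (x ^ p / (p.factorial : ℝ))) := by
  have hB : 0 < B := hx.trans_lt hxB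
  have hW : ∀ n, 0 ≤ nigW B n := fun n =>
    setIntegral_nonneg measurableSet_Ioi fun t ht => by
      have ht : 0 < t := ht
      positivity
  refine summable_of_sum_le (c := nigW (B - x) 2)
    (fun p => mul_nonneg (hW _) (by positivity)) fun u => ?_
  unfold nigW
  simp only [← integral_mul_const]
  rw [← integral_finsetSum _ fun p _ => (nigW_integrable hB (p + 2)).mul_const _]
  refine setIntegral_mono_on
    (integrable_finsetSum _ fun p _ => (nigW_integrable hB (p + 2)).mul_const _)
    (nigW_integrable (sub_pos.2 hxB) 2) measurableSet_Ioi fun t ht => ?_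
  have ht : 0 < t := ht
  have h1 : ∑ p ∈ u, (x / t) ^ p / (p.factorial : ℝ) ≤ Real.exp (x / t) :=
    sum_le_hasSum u (fun p _ => by positivity) (nig_hasSum_exp _)
  have h2 : Real.exp (-t - (B - x) / t) = Real.exp (-t - B / t) * Real.exp (x / t) := by
    rw [← Real.exp_add]; congr 1; ring
  calc _ = Real.exp (-t - B / t) * (t ^ 2)⁻¹ * ∑ p ∈ u, (x / t) ^ p / (p.factorial : ℝ) := by
        rw [Finset.mul_sum]
        refine Finset.sum_congr rfl fun p _ => ?_
        rw [div_pow, pow_add]; field_simp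
    _ ≤ Real.exp (-t - B / t) * (t ^ 2)⁻¹ * Real.exp (x / t) := by gcongr
    _ = _ := by rw [h2]; ring

lemma nigW_hasSum {B x : ℝ} (hxB : |x| < B) :
    HasSum (fun p : ℕ => nigW B (p + 2) * ((-x) ^ p / (p.factorial : ℝ))) (nigW (B + x) 2) := by
  have hB : 0 < B := (abs_nonneg x).trans_lt hxB
  have key := hasSum_integral_of_summable_integral_norm
    (μ := volume.restrict (Set.Ioi (0:ℝ)))
    (F := fun (p : ℕ) (t : ℝ) => Real.exp (-t - B / t) * (t ^ (p + 2))⁻¹ *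
      ((-x) ^ p / (p.factorial : ℝ)))
    (fun p => (nigW_integrable hB (p + 2)).mul_const _) (by
      refine (nigW_summable (abs_nonneg x) hxB).congr fun p => ?_
      unfold nigW
      rw [← integral_mul_const]
      refine setIntegral_congr_fun measurableSet_Ioi fun t ht => ?_
      have ht : 0 < t := ht
      have : 0 ≤ Real.exp (-t - B / t) * (t ^ (p + 2))⁻¹ := by positivity
      simp only [norm_mul, norm_div, norm_pow, norm_neg, Real.norm_eq_abs, Nat.abs_cast]
      rw [abs_of_pos (Real.exp_pos _), abs_of_pos (by positivity : 0 < (t ^ (p + 2))⁻¹)])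
  simp only [integral_mul_const] at key
  suffices hval : nigW (B + x) 2 = ∫ t in Set.Ioi (0:ℝ), ∑' p : ℕ,
      Real.exp (-t - B / t) * (t ^ (p + 2))⁻¹ * ((-x) ^ p / (p.factorial : ℝ)) by
    rw [hval]; exact key
  unfold nigW
  refine setIntegral_congr_fun measurableSet_Ioi fun t ht => ?_
  have ht : 0 < t := ht
  have h2 : Real.exp (-t - (B + x) / t) = Real.exp (-t - B / t) * Real.exp (-x / t) := by
    rw [← Real.exp_add]; congr 1; ring
  have h1 := ((nig_hasSum_exp (-x / t)).mul_left (Real.exp (-t - B / t) * (t ^ 2)⁻¹)).tsum_eq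
  rw [h2]
  rw [show Real.exp (-t - B / t) * Real.exp (-x / t) * (t ^ 2)⁻¹ =
    Real.exp (-t - B / t) * (t ^ 2)⁻¹ * Real.exp (-x / t) by ring, ← h1]
  refine tsum_congr fun p => ?_
  rw [div_pow, pow_add]; field_simp

lemma nigW_interval {B a k : ℝ} (ha : 0 < a) (hk : a * k ^ 2 < B) :
    HasSum (fun p : ℕ => nigW B (p + 2) * ((-a) ^ p / (p.factorial : ℝ)) *
      (k ^ (2 * p + 1) / (2 * (p : ℝ) + 1)))
      (∫ y in (0:ℝ)..k, nigW (B + a * y ^ 2) 2) := by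
  have hW : ∀ n, 0 ≤ nigW B n := fun n =>
    setIntegral_nonneg measurableSet_Ioi fun t ht => by
      have ht : 0 < t := ht
      positivity
  have hle : ∀ y ∈ Set.uIoc 0 k, a * y ^ 2 ≤ a * k ^ 2 := by
    intro y hy
    have : |y| ≤ |k| := by
      have := Set.abs_sub_left_of_mem_uIcc (Set.uIoc_subset_uIcc hy)
      simpa using this
    have := sq_le_sq.2 this
    gcongr
  have key := intervalIntegral.hasSum_integral_of_dominated_convergence (μ := volume)
    (a := 0) (b := k)
    (F := fun (p : ℕ) (y : ℝ) => nigW B (p + 2) * ((-(a * y ^ 2)) ^ p / (p.factorial : ℝ)))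
    (f := fun y => nigW (B + a * y ^ 2) 2)
    (fun p _ => nigW B (p + 2) * ((a * k ^ 2) ^ p / (p.factorial : ℝ)))
    (fun p => by
      apply Continuous.aestronglyMeasurable
      fun_prop)
    (fun p => Filter.Eventually.of_forall fun y hy => by
      have h := hle y hy
      rw [norm_mul, norm_div, norm_pow, norm_neg, Real.norm_of_nonneg (hW _),
        Real.norm_of_nonneg (by positivity : 0 ≤ a * y ^ 2), Real.norm_natCast]
      have := hW (p + 2)
      gcongr)
    (Filter.Eventually.of_forall fun y hy => nigW_summable (by positivity) hk)
    (intervalIntegrable_const)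
    (Filter.Eventually.of_forall fun y hy => nigW_hasSum (by
      rw [abs_of_nonneg (by positivity)]
      exact (hle y hy).trans_lt hk))
  refine key.congr_fun fun p => ?_
  have e : ∀ t : ℝ, nigW B (p + 2) * ((-(a * t ^ 2)) ^ p / (p.factorial : ℝ)) =
      nigW B (p + 2) * ((-a) ^ p / (p.factorial : ℝ)) * t ^ (2 * p) := by
    intro t
    rw [← neg_mul, mul_pow, pow_mul]; ring
  simp only [e]
  rw [intervalIntegral.integral_const_mul, integral_pow]
  simp

lemma nig_bessel {z : ℝ} (p : ℕ) :
    besselKr ((p : ℝ) + 1) z = 1 / 2 * (z / 2) ^ (p + 1) * nigW (z ^ 2 / 4) (p + 2) := by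
  unfold besselKr nigW
  have h1 : (z / 2) ^ ((p : ℝ) + 1) = (z / 2) ^ (p + 1) := by
    rw [← Real.rpow_natCast]; push_cast; rfl
  rw [h1]
  congr 1
  refine setIntegral_congr_fun measurableSet_Ioi fun t ht => ?_
  have ht : 0 < t := ht
  have h2 : t ^ (-((p : ℝ) + 1) - 1) = (t ^ (p + 2))⁻¹ := by
    rw [← Real.rpow_natCast, ← Real.rpow_neg ht.le]; congr 1; push_cast; ring
  simp only [h2]
  congr 3
  field_simp

lemma nig_density_eq {α δ μ x τ : ℝ} (hδ : 0 < δ) (hτ : 0 < τ) :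
    nigDensity α δ μ x τ = (α * δ * τ / Real.pi) * Real.exp (α * δ * τ) * (α / 4) *
      nigW ((α / 2) ^ 2 * ((δ * τ) ^ 2 + (x - μ * τ) ^ 2)) 2 := by
  unfold nigDensity
  have hs : 0 < (δ * τ) ^ 2 + (x - μ * τ) ^ 2 := by positivity
  have hss := Real.sqrt_pos.2 hs
  have h := nig_bessel (z := α * √((δ * τ) ^ 2 + (x - μ * τ) ^ 2)) 0
  simp only [Nat.cast_zero, zero_add, pow_one] at h
  rw [h, mul_pow α, Real.sq_sqrt hs.le,
    show α ^ 2 * ((δ * τ) ^ 2 + (x - μ * τ) ^ 2) / 4 =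
      (α / 2) ^ 2 * ((δ * τ) ^ 2 + (x - μ * τ) ^ 2) by ring]
  field_simp
  ring

lemma nig_term_eq {α δ τ k₀ : ℝ} (hα : 0 < α) (hδ : 0 < δ) (hτ : 0 < τ) (p : ℕ) :
    cnPutTerm α δ τ k₀ p = (δ * τ * α / 4) *
      (nigW ((α / 2) ^ 2 * (δ * τ) ^ 2) (p + 2) * ((-(α / 2) ^ 2) ^ p / (p.factorial : ℝ)) *
      (k₀ ^ (2 * p + 1) / (2 * (p : ℝ) + 1))) := by
  unfold cnPutTerm
  rw [nig_bessel, Real.rpow_neg (by positivity), Real.rpow_natCast,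
    show (α * δ * τ) ^ 2 / 4 = (α / 2) ^ 2 * (δ * τ) ^ 2 by ring]
  have e : (α * δ * τ / 2) ^ (p + 1) * ((2 * δ * τ / α) ^ p)⁻¹ =
      (α * δ * τ / 2) * ((α / 2) ^ 2) ^ p := by
    rw [← inv_pow, pow_succ', mul_assoc, ← mul_pow]
    congr 2
    field_simp
  rw [neg_pow ((α / 2) ^ 2) p, ← div_div]
  linear_combination ((-1 : ℝ) ^ p * k₀ ^ (2 * p + 1) / (p.factorial : ℝ) / (2 * (p : ℝ) + 1) *
    (1 / 2) * nigW ((α / 2) ^ 2 * (δ * τ) ^ 2) (p + 2)) * e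

/-- Cash-or-nothing put pricing formula in the symmetric exponential NIG model. -/
theorem cash_or_nothing_put_symmetric
    (α δ μ S K r q τ : ℝ)
    (hα : 0 < α) (hδ : 0 < δ) (hS : 0 < S) (hK : 0 < K)
    (hr : 0 ≤ r) (hq : 0 ≤ q) (hτ : 0 < τ)
    (ω k k₀ : ℝ)
    (hω : ω = -μ + δ * (Real.sqrt (α ^ 2 - 1) - α))
    (hk : k = Real.log (S / K) + (r - q + ω) * τ)
    (hk₀ : k₀ = k + μ * τ)
    (hconv : |k₀| < δ * τ) :
    Summable (fun p : ℕ => cnPutTerm α δ τ k₀ p) ∧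
    Real.exp (-r * τ) *
        (∫ x : ℝ, (if x < -k then (1 : ℝ) else 0) * nigDensity α δ μ x τ)
      = Real.exp (-r * τ) *
          (1 / 2 - α / Real.pi * Real.exp (α * δ * τ) *
            ∑' p : ℕ, cnPutTerm α δ τ k₀ p) := by

  set m : ℝ := α / 2 with hm
  set c : ℝ := δ * τ with hc
  have hm0 : 0 < m := by positivity
  have hc0 : 0 < c := by positivity
  set h : ℝ → ℝ := fun y => nigW (m ^ 2 * (c ^ 2 + y ^ 2)) 2 with hh
  obtain ⟨hint, htot⟩ := nigW_total hm0 hc0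
  have hkc : m ^ 2 * k₀ ^ 2 < m ^ 2 * c ^ 2 := by
    have : k₀ ^ 2 < c ^ 2 := sq_lt_sq.2 (by rwa [abs_of_pos hc0])
    gcongr
  have hser := nigW_interval (by positivity : 0 < m ^ 2) hkc
  have hser2 : HasSum (fun p : ℕ => cnPutTerm α δ τ k₀ p)
      (c * α / 4 * ∫ y in (0:ℝ)..k₀, h y) := by
    have := hser.mul_left (c * α / 4)
    simp only [← mul_add] at this
    refine this.congr_fun fun p => ?_
    exact nig_term_eq hα hδ hτ p
  refine ⟨hser2.summable, ?_⟩
  rw [hser2.tsum_eq]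
  congr 1
  have h1 : ∫ x : ℝ, (if x < -k then (1 : ℝ) else 0) * nigDensity α δ μ x τ =
      α * c / Real.pi * Real.exp (α * c) * (α / 4) * ∫ y in Set.Iic (-k₀), h y := by
    rw [integral_Iic_eq_integral_Iio, ← integral_const_mul,
      ← integral_indicator measurableSet_Iio]
    conv_rhs => rw [← integral_sub_right_eq_self _ (μ * τ)]
    refine integral_congr_ae (Filter.Eventually.of_forall fun x => ?_)
    have hx : (x < -k) ↔ (x - μ * τ ∈ Set.Iio (-k₀)) := by
      rw [Set.mem_Iio, hk₀]
      constructor <;> intro h <;> linarith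
    simp only [Set.indicator_apply, ← hx, nig_density_eq hδ hτ]
    split_ifs
    · simp only [hh, hc, hm]; ring_nf
    · simp
  have hsym : ∫ y in Set.Iic (-k₀), h y = ∫ y in Set.Ioi k₀, h y := by
    rw [← integral_comp_neg_Ioi]
    simp [hh]
  have hhalf : ∫ y, h y = 2 * ∫ y in Set.Ioi (0:ℝ), h y := by
    rw [← integral_comp_abs]
    simp [hh]
  have hsplit := intervalIntegral.integral_interval_add_Ioi (f := h) (μ := volume) (a := 0) (b := k₀)
    hint.integrableOn hint.integrableOn
  have htot' : ∫ y, h y = Real.pi / (m ^ 2 * c) * Real.exp (-(2 * (m * c))) := htot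
  have hv : ∫ y in Set.Ioi k₀, h y = Real.pi / (m ^ 2 * c) * Real.exp (-(2 * (m * c))) / 2
      - ∫ y in (0:ℝ)..k₀, h y := by linarith
  rw [h1, hsym, hv]
  have he : Real.exp (α * c) * Real.exp (-(2 * (m * c))) = 1 := by
    rw [← Real.exp_add, hm]; ring_nf; simp
  have hq : α * c / Real.pi * (α / 4) * (Real.pi / (m ^ 2 * c)) = 1 := by
    have := Real.pi_pos
    rw [hm]; field_simp; norm_num
  rw [show α * δ * τ = α * c by rw [hc]; ring]
  generalize (∫ y in (0:ℝ)..k₀, h y) = J at *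
  linear_combination (1 / 2 * α * c / Real.pi * (α / 4) * (Real.pi / (m ^ 2 * c))) * he + 1 / 2 * hq
end

section
/- Capped cash-or-nothing call (symmetric model): let 0 < K₋ < K₊, set k_± := log(S_t/K_±) + (r−q+ω)τ and k_{0,±} := k_± + μτ, and assume |k_{0,−}| < δτ and |k_{0,+}| < δτ. Then the price C := e^{−rτ} ∫_ℝ 1_{{−k_− < x < −k_+}} f(x,τ) dx of the capped digital option (payoff 1_{{K₋ < S_T < K₊}}) equals the convergent series C = (α e^{(αδ−r)τ}/√π) · Σ_{n=0}^∞ [(k_{0,−}^n − k_{0,+}^n) / (n! Γ(1 − n/2))] · K_{(n+1)/2}(αδτ) · (δτ/(2α))^{(1−n)/2}. -/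
open MeasureTheory

/-- General term of the capped cash-or-nothing call series in the symmetric model. -/
noncomputable def cappedTerm (α δ τ k₀m k₀p : ℝ) (n : ℕ) : ℝ :=
  (k₀m ^ n - k₀p ^ n) / (n.factorial : ℝ) * (Real.Gamma (1 - (n : ℝ) / 2))⁻¹ *
    besselKr (((n : ℝ) + 1) / 2) (α * δ * τ) *
    (δ * τ / (2 * α)) ^ ((1 - (n : ℝ)) / 2)

noncomputable def JJ (A : ℝ) (m : ℕ) : ℝ :=
  ∫ t in Set.Ioi (0 : ℝ), Real.exp (-t - A / t) * (1 / t) ^ (m + 2)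

lemma JJ_integrable {A : ℝ} (hA : 0 < A) (m : ℕ) :
    IntegrableOn (fun t : ℝ => Real.exp (-t - A / t) * (1 / t) ^ (m + 2)) (Set.Ioi 0) := by
  have h1 : IntegrableOn (fun t : ℝ => ((m + 2).factorial : ℝ) / A ^ (m + 2) * Real.exp (-t))
      (Set.Ioi 0) := by
    have := (exp_neg_integrableOn_Ioi 0 one_pos)
    simp only [neg_mul, one_mul] at this
    exact this.const_mul _
  refine Integrable.mono' h1 ?_ ?_
  · apply Measurable.aestronglyMeasurable
    fun_prop
  · filter_upwards [ae_restrict_mem measurableSet_Ioi] with t ht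
    have ht : 0 < t := ht
    rw [Real.norm_of_nonneg (by positivity)]
    have h2 := Real.pow_div_factorial_le_exp (x := A / t) (by positivity) (m + 2)
    rw [sub_eq_add_neg, Real.exp_add, Real.exp_neg (A / t)]
    have h3 : (Real.exp (A / t))⁻¹ ≤ ((A / t) ^ (m + 2) / ((m + 2).factorial : ℝ))⁻¹ :=
      inv_anti₀ (by positivity) h2
    calc _ ≤ Real.exp (-t) * ((A / t) ^ (m + 2) / ((m + 2).factorial : ℝ))⁻¹ * (1 / t) ^ (m + 2) := by
          gcongr
      _ = _ := by
          rw [div_pow, div_pow, one_pow]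
          field_simp

lemma JJ_nonneg (A : ℝ) (m : ℕ) : 0 ≤ JJ A m := by
  apply setIntegral_nonneg measurableSet_Ioi
  intro t ht
  have ht : 0 < t := ht
  positivity

lemma JJ_summable {A B : ℝ} (hB : 0 ≤ B) (hBA : B < A) :
    Summable (fun m : ℕ => B ^ m / (m.factorial : ℝ) * JJ A m) := by
  have hA : 0 < A := hB.trans_lt hBA
  refine summable_of_sum_range_le (c := JJ (A - B) 0)
    (fun m => mul_nonneg (by positivity) (JJ_nonneg A m)) (fun n => ?_)
  simp only [JJ, ← integral_const_mul]
  rw [← integral_finsetSum _ (fun i _ => (JJ_integrable hA i).const_mul _)]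
  refine setIntegral_mono_on (integrable_finsetSum _ (fun i _ => (JJ_integrable hA i).const_mul _))
    (JJ_integrable (sub_pos.2 hBA) 0) measurableSet_Ioi (fun t ht => ?_)
  have ht : 0 < t := ht
  have h := Real.sum_le_exp_of_nonneg (x := B / t) (by positivity) n
  calc _ = (∑ i ∈ Finset.range n, (B / t) ^ i / (i.factorial : ℝ)) *
        (Real.exp (-t - A / t) * (1 / t) ^ 2) := by
        rw [Finset.sum_mul]
        refine Finset.sum_congr rfl (fun i _ => ?_)
        simp only [div_pow, one_pow, pow_add]
        field_simp
    _ ≤ Real.exp (B / t) * (Real.exp (-t - A / t) * (1 / t) ^ 2) := by gcongr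
    _ = _ := by
        rw [← mul_assoc, ← Real.exp_add]
        congr 2
        ring

lemma JJ_hasSum {A B : ℝ} (hB : 0 ≤ B) (hBA : B < A) :
    HasSum (fun m : ℕ => (-B) ^ m / (m.factorial : ℝ) * JJ A m) (JJ (A + B) 0) := by
  have hA : 0 < A := hB.trans_lt hBA
  have h := hasSum_integral_of_summable_integral_norm (μ := volume.restrict (Set.Ioi (0 : ℝ)))
    (F := fun (m : ℕ) (t : ℝ) => (-B) ^ m / (m.factorial : ℝ) *
      (Real.exp (-t - A / t) * (1 / t) ^ (m + 2)))
    (fun i => (JJ_integrable hA i).const_mul _) ?_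
  · simp only [integral_const_mul] at h
    refine (congrArg (fun v : ℝ => HasSum (fun m : ℕ => (-B) ^ m / (m.factorial : ℝ) * JJ A m) v)
      ?_).mp h
    symm
    refine setIntegral_congr_fun measurableSet_Ioi (fun t ht => ?_)
    have ht : 0 < t := ht
    symm
    have h2 := (NormedSpace.expSeries_div_hasSum_exp (𝔸 := ℝ) (-B / t)).mul_right
      (Real.exp (-t - A / t) * (1 / t) ^ 2)
    rw [← Real.exp_eq_exp_ℝ, ← mul_assoc, ← Real.exp_add] at h2
    have e1 : (fun i : ℕ => (-B / t) ^ i / (i.factorial : ℝ) *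
        (Real.exp (-t - A / t) * (1 / t) ^ 2)) = fun i : ℕ => (-B) ^ i / (i.factorial : ℝ) *
        (Real.exp (-t - A / t) * (1 / t) ^ (i + 2)) := by
      funext i
      simp only [div_pow, one_pow, pow_add]
      field_simp
    have e2 : -B / t + (-t - A / t) = -t - (A + B) / t := by ring
    rw [e1, e2] at h2
    exact h2.tsum_eq
  · convert JJ_summable hB hBA using 2 with m
    rw [JJ, ← integral_const_mul]
    refine setIntegral_congr_fun measurableSet_Ioi (fun t ht => ?_)
    have ht : 0 < t := ht
    simp only [norm_mul, norm_div, norm_pow, norm_neg, Real.norm_eq_abs, abs_of_nonneg hB,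
      Real.abs_exp, abs_of_pos ht, abs_one, Nat.abs_cast]

lemma besselKr_nat (m : ℕ) (z : ℝ) (hz : 0 < z) :
    besselKr ((m : ℝ) + 1) z = (1 / 2) * (z / 2) ^ (m + 1) * JJ (z ^ 2 / 4) m := by
  unfold besselKr JJ
  congr 1
  · congr 1
    exact_mod_cast Real.rpow_natCast (z / 2) (m + 1)
  · refine setIntegral_congr_fun measurableSet_Ioi (fun t ht => ?_)
    have ht : 0 < t := ht
    congr 1
    · congr 2
      field_simp
    · rw [show (-((m : ℝ) + 1) - 1) = -((m + 2 : ℕ) : ℝ) by push_cast; ring, Real.rpow_neg ht.le,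
        Real.rpow_natCast, one_div, inv_pow]

lemma gamma_half_sub (m : ℕ) :
    (Real.Gamma (1 / 2 - (m : ℝ)))⁻¹ =
      (-1) ^ m * ((2 * m).factorial : ℝ) / (4 ^ m * (m.factorial : ℝ) * Real.sqrt Real.pi) := by
  induction m with
  | zero => simp [← one_div, Real.Gamma_one_half_eq]
  | succ m ih =>
    have hne : (1 / 2 - ((m + 1 : ℕ) : ℝ)) ≠ 0 := by
      push_cast
      have : (0 : ℝ) ≤ m := by positivity
      intro h
      linarith
    have h := Real.Gamma_add_one hne
    rw [show (1 / 2 - ((m + 1 : ℕ) : ℝ)) + 1 = 1 / 2 - (m : ℝ) by push_cast; ring] at h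
    have h2 : (Real.Gamma (1 / 2 - ((m + 1 : ℕ) : ℝ)))⁻¹ =
        (1 / 2 - ((m + 1 : ℕ) : ℝ)) * (Real.Gamma (1 / 2 - (m : ℝ)))⁻¹ := by
      rw [h, mul_inv, mul_inv_cancel_left₀ hne]
    rw [h2, ih, show 2 * (m + 1) = 2 * m + 1 + 1 by ring, Nat.factorial_succ, Nat.factorial_succ,
      Nat.factorial_succ]
    have hp : 0 < Real.sqrt Real.pi := Real.sqrt_pos.2 Real.pi_pos
    push_cast
    field_simp
    ring

lemma nig_eq (α δ μ x τ : ℝ) (hα : 0 < α) (hD : 0 < δ * τ) :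
    nigDensity α δ μ x τ = (α * δ * τ / Real.pi) * Real.exp (α * δ * τ) * (α / 4) *
      JJ ((α * (δ * τ)) ^ 2 / 4 + (α * (x - μ * τ)) ^ 2 / 4) 0 := by
  have hR : 0 < (δ * τ) ^ 2 + (x - μ * τ) ^ 2 := by positivity
  have hs : 0 < Real.sqrt ((δ * τ) ^ 2 + (x - μ * τ) ^ 2) := Real.sqrt_pos.2 hR
  have h := besselKr_nat 0 (α * Real.sqrt ((δ * τ) ^ 2 + (x - μ * τ) ^ 2)) (by positivity)
  simp only [Nat.cast_zero, zero_add, pow_one] at h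
  rw [mul_pow α, Real.sq_sqrt hR.le] at h
  rw [nigDensity, h, show α ^ 2 * ((δ * τ) ^ 2 + (x - μ * τ) ^ 2) / 4 =
    (α * (δ * τ)) ^ 2 / 4 + (α * (x - μ * τ)) ^ 2 / 4 by ring]
  generalize Real.sqrt ((δ * τ) ^ 2 + (x - μ * τ) ^ 2) = R at hs
  generalize JJ ((α * (δ * τ)) ^ 2 / 4 + (α * (x - μ * τ)) ^ 2 / 4) 0 = J
  field_simp
  try ring

lemma odd_term (α δ τ a b : ℝ) (m : ℕ) (hα : 0 < α) (hδ : 0 < δ) (hτ : 0 < τ) :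
    cappedTerm α δ τ a b (2 * m + 1) =
      (a ^ (2 * m + 1) - b ^ (2 * m + 1)) / (2 * m + 1) *
      ((-(α ^ 2 / 4)) ^ m / (m.factorial : ℝ) * JJ ((α * (δ * τ)) ^ 2 / 4) m) *
      (α * δ * τ / 4 / Real.sqrt Real.pi) := by
  unfold cappedTerm
  rw [show (1 - ((2 * m + 1 : ℕ) : ℝ) / 2) = 1 / 2 - (m : ℝ) by push_cast; ring, gamma_half_sub,
    show ((((2 * m + 1 : ℕ) : ℝ) + 1) / 2) = (m : ℝ) + 1 by push_cast; ring,
    besselKr_nat m _ (by positivity),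
    show ((1 - ((2 * m + 1 : ℕ) : ℝ)) / 2) = -(m : ℝ) by push_cast; ring,
    Real.rpow_neg (by positivity), Real.rpow_natCast, Nat.factorial_succ, ← mul_assoc α δ τ]
  have hp : 0 < Real.sqrt Real.pi := Real.sqrt_pos.2 Real.pi_pos
  have hk : (α * δ * τ / 2) ^ (m + 1) * ((δ * τ / (2 * α)) ^ m)⁻¹ =
      (α ^ 2) ^ m * (α * δ * τ / 2) := by
    rw [pow_succ, show α * δ * τ / 2 = α ^ 2 * (δ * τ / (2 * α)) by field_simp, mul_pow]
    field_simp
  have hn : (-(α ^ 2 / 4)) ^ m = (-1) ^ m * (α ^ 2) ^ m / 4 ^ m := by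
    rw [neg_pow, div_pow]
    ring
  rw [hn]
  generalize JJ ((α * δ * τ) ^ 2 / 4) m = J
  calc _ = (a ^ (2 * m + 1) - b ^ (2 * m + 1)) / (((2 * m + 1) * (2 * m).factorial : ℕ) : ℝ) *
        ((-1) ^ m * ((2 * m).factorial : ℝ) / (4 ^ m * (m.factorial : ℝ) * Real.sqrt Real.pi)) *
        (1 / 2 * J) * ((α * δ * τ / 2) ^ (m + 1) * ((δ * τ / (2 * α)) ^ m)⁻¹) := by ring
    _ = _ := by
      rw [hk]
      push_cast
      field_simp
      try ring

lemma even_term (α δ τ a b : ℝ) (m : ℕ) : cappedTerm α δ τ a b (2 * m) = 0 := by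
  unfold cappedTerm
  rcases Nat.eq_zero_or_pos m with rfl | hm
  · simp
  · obtain ⟨k, rfl⟩ : ∃ k, m = k + 1 := ⟨m - 1, by omega⟩
    rw [show (1 - ((2 * (k + 1) : ℕ) : ℝ) / 2) = -(k : ℝ) by push_cast; ring,
      Real.Gamma_neg_nat_eq_zero]
    simp

lemma int_hasSum (α D a b : ℝ) (hα : 0 < α) (ha : |a| < D) (hb : |b| < D) :
    HasSum (fun m : ℕ => (a ^ (2 * m + 1) - b ^ (2 * m + 1)) / (2 * m + 1) *
      ((-(α ^ 2 / 4)) ^ m / (m.factorial : ℝ) * JJ ((α * D) ^ 2 / 4) m))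
      (∫ y in (-a)..(-b), JJ ((α * D) ^ 2 / 4 + (α * y) ^ 2 / 4) 0) := by
  set M := max |a| |b| with hM
  have hM0 : 0 ≤ M := le_max_of_le_left (abs_nonneg a)
  have hMD : M < D := max_lt ha hb
  have hlt : ∀ y : ℝ, |y| ≤ M → (α * y) ^ 2 / 4 < (α * D) ^ 2 / 4 := by
    intro y hy
    have : y ^ 2 < D ^ 2 := by
      apply sq_lt_sq'
      · linarith [neg_abs_le y]
      · linarith [le_abs_self y]
    rw [mul_pow, mul_pow]
    have : α ^ 2 * y ^ 2 < α ^ 2 * D ^ 2 := by gcongr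
    linarith
  have hy : ∀ y ∈ Set.uIoc (-a) (-b), |y| ≤ M := by
    intro y hy
    have hy := Set.uIoc_subset_uIcc hy
    rw [Set.mem_uIcc] at hy
    have := le_max_left |a| |b|
    have := le_max_right |a| |b|
    rw [abs_le]
    rcases hy with hy | hy <;> constructor <;>
      linarith [neg_abs_le a, le_abs_self a, neg_abs_le b, le_abs_self b]
  have hsum := JJ_summable (B := (α * M) ^ 2 / 4) (by positivity)
    (hlt M (by rw [abs_of_nonneg hM0]))
  have h := intervalIntegral.hasSum_integral_of_dominated_convergence (μ := volume)
    (a := -a) (b := -b)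
    (F := fun (m : ℕ) (y : ℝ) => y ^ (2 * m) *
      ((-(α ^ 2 / 4)) ^ m / (m.factorial : ℝ) * JJ ((α * D) ^ 2 / 4) m))
    (f := fun y => JJ ((α * D) ^ 2 / 4 + (α * y) ^ 2 / 4) 0)
    (fun m _ => ((α * M) ^ 2 / 4) ^ m / (m.factorial : ℝ) * JJ ((α * D) ^ 2 / 4) m)
    ?_ ?_ ?_ ?_ ?_
  · refine (congrArg (fun g : ℕ → ℝ => HasSum g
      (∫ y in (-a)..(-b), JJ ((α * D) ^ 2 / 4 + (α * y) ^ 2 / 4) 0)) ?_).mp h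
    funext m
    rw [intervalIntegral.integral_mul_const, integral_pow]
    congr 2
    · rw [Odd.neg_pow ⟨m, rfl⟩, Odd.neg_pow ⟨m, rfl⟩]
      ring
    · push_cast
      rfl
  · intro m
    apply Measurable.aestronglyMeasurable
    fun_prop
  · intro m
    refine Filter.Eventually.of_forall (fun y hyy => ?_)
    have h1 := hy y hyy
    rw [norm_mul, norm_mul, norm_div, norm_pow, norm_pow, norm_neg, Real.norm_eq_abs,
      Real.norm_eq_abs, Real.norm_eq_abs, Real.norm_eq_abs, Nat.abs_cast,
      abs_of_nonneg (JJ_nonneg _ _), abs_of_nonneg (show 0 ≤ α ^ 2 / 4 by positivity)]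
    rw [show (α * M) ^ 2 / 4 = M ^ 2 * (α ^ 2 / 4) by ring, mul_pow (M ^ 2), ← pow_mul]
    have h2 : |y| ^ (2 * m) ≤ M ^ (2 * m) := by gcongr
    have h3 := JJ_nonneg ((α * D) ^ 2 / 4) m
    rw [mul_div_assoc, mul_assoc (M ^ (2 * m))]
    gcongr
  · exact Filter.Eventually.of_forall (fun y _ => hsum)
  · exact intervalIntegrable_const
  · refine Filter.Eventually.of_forall (fun y hyy => ?_)
    have h1 := JJ_hasSum (B := (α * y) ^ 2 / 4) (by positivity) (hlt y (hy y hyy))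
    refine (congrArg (fun g : ℕ → ℝ => HasSum g
      (JJ ((α * D) ^ 2 / 4 + (α * y) ^ 2 / 4) 0)) ?_).mp h1
    funext m
    rw [show -((α * y) ^ 2 / 4) = y ^ 2 * (-(α ^ 2 / 4)) by ring, mul_pow (y ^ 2), ← pow_mul]
    ring

/-- Capped cash-or-nothing call pricing formula in the symmetric exponential NIG model. -/
theorem capped_cash_or_nothing_call_symmetric
    (α δ μ S r q τ : ℝ) (Km Kp : ℝ)
    (hα : 0 < α) (hδ : 0 < δ) (hS : 0 < S)
    (hKm : 0 < Km) (hKmKp : Km < Kp)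
    (hr : 0 ≤ r) (hq : 0 ≤ q) (hτ : 0 < τ)
    (ω km kp k₀m k₀p : ℝ)
    (hω : ω = -μ + δ * (Real.sqrt (α ^ 2 - 1) - α))
    (hkm : km = Real.log (S / Km) + (r - q + ω) * τ)
    (hkp : kp = Real.log (S / Kp) + (r - q + ω) * τ)
    (hk₀m : k₀m = km + μ * τ)
    (hk₀p : k₀p = kp + μ * τ)
    (hconvm : |k₀m| < δ * τ) (hconvp : |k₀p| < δ * τ) :
    Summable (fun n : ℕ => cappedTerm α δ τ k₀m k₀p n) ∧
    Real.exp (-r * τ) *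
        (∫ x : ℝ, (if -km < x ∧ x < -kp then (1 : ℝ) else 0) * nigDensity α δ μ x τ)
      = α * Real.exp ((α * δ - r) * τ) / Real.sqrt Real.pi *
          ∑' n : ℕ, cappedTerm α δ τ k₀m k₀p n := by
  have hD : 0 < δ * τ := mul_pos hδ hτ
  have hKp : 0 < Kp := hKm.trans hKmKp
  have hkk : kp < km := by
    have : Real.log (S / Kp) < Real.log (S / Km) := by
      apply Real.log_lt_log (by positivity)
      gcongr
    rw [hkm, hkp]
    linarith
  have h1 := (int_hasSum α (δ * τ) k₀m k₀p hα hconvm hconvp).mul_right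
    (α * δ * τ / 4 / Real.sqrt Real.pi)
  simp only [← odd_term α δ τ k₀m k₀p _ hα hδ hτ] at h1
  have hinj : Function.Injective (fun m : ℕ => 2 * m + 1) := by
    intro x y hxy
    simp only at hxy
    omega
  have h2 := (hinj.hasSum_iff (f := fun n : ℕ => cappedTerm α δ τ k₀m k₀p n) ?_).1 h1
  swap
  · intro n hn
    rcases Nat.even_or_odd' n with ⟨k, rfl | rfl⟩
    · exact even_term _ _ _ _ _ _
    · exact absurd ⟨k, rfl⟩ hn
  refine ⟨h2.summable, ?_⟩
  rw [h2.tsum_eq]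
  have h3 : (∫ x : ℝ, (if -km < x ∧ x < -kp then (1 : ℝ) else 0) * nigDensity α δ μ x τ) =
      ∫ x in (-km)..(-kp), nigDensity α δ μ x τ := by
    rw [intervalIntegral.integral_of_le (by linarith), integral_Ioc_eq_integral_Ioo,
      ← integral_indicator measurableSet_Ioo]
    congr 1
    funext x
    simp [Set.indicator_apply]
  rw [h3]
  simp only [nig_eq α δ μ _ τ hα hD]
  rw [intervalIntegral.integral_const_mul,
    intervalIntegral.integral_comp_sub_right
      (fun y => JJ ((α * (δ * τ)) ^ 2 / 4 + (α * y) ^ 2 / 4) 0) (μ * τ),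
    show -km - μ * τ = -k₀m by rw [hk₀m]; ring, show -kp - μ * τ = -k₀p by rw [hk₀p]; ring]
  rw [show (α * δ - r) * τ = α * δ * τ + -r * τ by ring, Real.exp_add]
  have hp : 0 < Real.sqrt Real.pi := Real.sqrt_pos.2 Real.pi_pos
  generalize (∫ y in (-k₀m)..(-k₀p), JJ ((α * (δ * τ)) ^ 2 / 4 + (α * y) ^ 2 / 4) 0) = I
  have hpi : Real.pi = Real.sqrt Real.pi * Real.sqrt Real.pi :=
    (Real.mul_self_sqrt Real.pi_pos.le).symm
  have hpi' : α * δ * τ / Real.pi = α * δ * τ / (Real.sqrt Real.pi * Real.sqrt Real.pi) := by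
    rw [← hpi]
  rw [hpi']
  field_simp
end
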